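/- arXiv:2511.21384 — 2 statements merged into one kernel-verified Lean document; each statement's English description precedes it below -/
import Mathlib

section
/- For every g in GSp₄(ℚ_ℓ) there exist (μ',μ) ∈ Λ₀⁺⁺ × Λ⁺, h ∈ H(ℤ_ℓ) and k ∈ GSp₄(ℤ_ℓ) such that g = ι(h)·𝐠(μ',μ)·k. (Existence part of the Cartan-type decomposition GSp₄(ℚ_ℓ) = ⊔ H(ℤ_ℓ)𝐠(μ',μ)GSp₄(ℤ_ℓ).) -/
/- STATEMENT 0: Existence part of the Cartan-type decomposition
   GSp₄(ℚ_ℓ) = ⊔ H(ℤ_ℓ) 𝐠(μ',μ) GSp₄(ℤ_ℓ). -/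

open Matrix

noncomputable section

variable (ℓ : ℕ) [Fact ℓ.Prime]

/-- The 4×4 skew-symmetric matrix `J` defining `GSp₄`. -/
def Jmat : Matrix (Fin 4) (Fin 4) ℚ_[ℓ] :=
  !![0, 0, 0, 1; 0, 0, 1, 0; 0, -1, 0, 0; -1, 0, 0, 0]

/-- Membership in `GSp₄(ℚ_ℓ)` for an element of `GL₄(ℚ_ℓ)`:
`gᵀ J g = μ(g) J` for some unit `μ(g)`. -/
def IsGSp4 (g : GL (Fin 4) ℚ_[ℓ]) : Prop :=
  ∃ u : (ℚ_[ℓ])ˣ,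
    (g : Matrix (Fin 4) (Fin 4) ℚ_[ℓ])ᵀ * Jmat ℓ * (g : Matrix (Fin 4) (Fin 4) ℚ_[ℓ]) =
      (u : ℚ_[ℓ]) • Jmat ℓ

/-- `g` has all entries in `ℤ_ℓ` and so does its inverse, i.e. `g` lies in the
integral points of the general linear group. -/
def IsIntegralGL {n : ℕ} (g : GL (Fin n) ℚ_[ℓ]) : Prop :=
  (∀ i j, ‖(g : Matrix (Fin n) (Fin n) ℚ_[ℓ]) i j‖ ≤ 1) ∧
    (∀ i j, ‖((g⁻¹ : GL (Fin n) ℚ_[ℓ]) : Matrix (Fin n) (Fin n) ℚ_[ℓ]) i j‖ ≤ 1)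

/-- The embedding `ι : H → GSp₄` on the level of matrices. -/
def iotaMat (h₁ h₂ : Matrix (Fin 2) (Fin 2) ℚ_[ℓ]) : Matrix (Fin 4) (Fin 4) ℚ_[ℓ] :=
  !![h₁ 0 0, 0, 0, h₁ 0 1;
     0, h₂ 0 0, h₂ 0 1, 0;
     0, h₂ 1 0, h₂ 1 1, 0;
     h₁ 1 0, 0, 0, h₁ 1 1]

/-- The diagonal matrix `𝐭(ν) = diag(ℓ^{ν₁}, ℓ^{ν₂}, ℓ^{ν₃-ν₂}, ℓ^{ν₃-ν₁})`. -/
def tMat (ν : Fin 3 → ℤ) : Matrix (Fin 4) (Fin 4) ℚ_[ℓ] :=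
  Matrix.diagonal ![(ℓ : ℚ_[ℓ]) ^ (ν 0), (ℓ : ℚ_[ℓ]) ^ (ν 1),
    (ℓ : ℚ_[ℓ]) ^ (ν 2 - ν 1), (ℓ : ℚ_[ℓ]) ^ (ν 2 - ν 0)]

/-- The matrix `B`. -/
def Bmat : Matrix (Fin 4) (Fin 4) ℚ_[ℓ] :=
  !![1, 1, 1, 0; 0, 1, 0, 1; 0, 0, 1, -1; 0, 0, 0, 1]

/-- The representatives `𝐠(μ',μ) = 𝐭(μ') B 𝐭(μ)`. -/
def gRep (μ' μ : Fin 3 → ℤ) : Matrix (Fin 4) (Fin 4) ℚ_[ℓ] :=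
  tMat ℓ μ' * Bmat ℓ * tMat ℓ μ

/-- `μ ∈ Λ⁺`. -/
def InLambdaPlus (μ : Fin 3 → ℤ) : Prop := μ 1 ≤ μ 0 ∧ μ 2 ≤ 2 * μ 1

/-- `μ' ∈ Λ₀⁺⁺`. -/
def InLambdaZeroPlusPlus (μ' : Fin 3 → ℤ) : Prop := 0 ≤ μ' 0 ∧ μ' 2 ≤ 2 * μ' 1

section Lemmas

variable {ℓ} {n : ℕ}

/-- A matrix over `ℚ_ℓ` with entries in `ℤ_ℓ`. -/
def IsIntegralMat (M : Matrix (Fin n) (Fin n) ℚ_[ℓ]) : Prop := ∀ i j, ‖M i j‖ ≤ 1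

/-- A matrix over `ℚ_ℓ` which lies in `GL_n(ℤ_ℓ)`. -/
def IsUnimodular (M : Matrix (Fin n) (Fin n) ℚ_[ℓ]) : Prop := IsIntegralMat M ∧ ‖M.det‖ = 1

lemma IsIntegralMat.exists_map {M : Matrix (Fin n) (Fin n) ℚ_[ℓ]} (h : IsIntegralMat M) :
    ∃ N : Matrix (Fin n) (Fin n) ℤ_[ℓ], PadicInt.Coe.ringHom.mapMatrix N = M :=
  ⟨Matrix.of fun i j => ⟨M i j, h i j⟩, by ext i j; rfl⟩

lemma isIntegralMat_map (N : Matrix (Fin n) (Fin n) ℤ_[ℓ]) :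
    IsIntegralMat (PadicInt.Coe.ringHom.mapMatrix N) := fun i j => PadicInt.norm_le_one (N i j)

lemma IsIntegralMat.mul {M N : Matrix (Fin n) (Fin n) ℚ_[ℓ]} (hM : IsIntegralMat M)
    (hN : IsIntegralMat N) : IsIntegralMat (M * N) := by
  obtain ⟨M, rfl⟩ := hM.exists_map
  obtain ⟨N, rfl⟩ := hN.exists_map
  rw [← map_mul]
  exact isIntegralMat_map _

lemma IsIntegralMat.norm_det_le {M : Matrix (Fin n) (Fin n) ℚ_[ℓ]} (hM : IsIntegralMat M) :
    ‖M.det‖ ≤ 1 := by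
  obtain ⟨M, rfl⟩ := hM.exists_map
  rw [← RingHom.map_det]
  exact PadicInt.norm_le_one _

lemma IsIntegralMat.smul {M : Matrix (Fin n) (Fin n) ℚ_[ℓ]} (hM : IsIntegralMat M)
    {c : ℚ_[ℓ]} (hc : ‖c‖ ≤ 1) : IsIntegralMat (c • M) := fun i j => by
  rw [Matrix.smul_apply, smul_eq_mul, norm_mul]
  exact mul_le_one₀ hc (norm_nonneg _) (hM i j)

lemma norm_sub_le_one {x y : ℚ_[ℓ]} (hx : ‖x‖ ≤ 1) (hy : ‖y‖ ≤ 1) : ‖x - y‖ ≤ 1 := by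
  rw [sub_eq_add_neg]
  exact (IsUltrametricDist.norm_add_le_max x (-y)).trans (max_le hx (by rwa [norm_neg]))

lemma norm_add_le_one {x y : ℚ_[ℓ]} (hx : ‖x‖ ≤ 1) (hy : ‖y‖ ≤ 1) : ‖x + y‖ ≤ 1 :=
  (IsUltrametricDist.norm_add_le_max x y).trans (max_le hx hy)

lemma IsIntegralMat.sub {M N : Matrix (Fin n) (Fin n) ℚ_[ℓ]} (hM : IsIntegralMat M)
    (hN : IsIntegralMat N) : IsIntegralMat (M - N) := fun i j =>
  norm_sub_le_one (hM i j) (hN i j)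

lemma IsUnimodular.one : IsUnimodular (1 : Matrix (Fin n) (Fin n) ℚ_[ℓ]) := by
  refine ⟨fun i j => ?_, by simp⟩
  rw [Matrix.one_apply]
  split_ifs <;> simp

lemma IsUnimodular.mul {M N : Matrix (Fin n) (Fin n) ℚ_[ℓ]} (hM : IsUnimodular M)
    (hN : IsUnimodular N) : IsUnimodular (M * N) :=
  ⟨hM.1.mul hN.1, by rw [Matrix.det_mul, norm_mul, hM.2, hN.2, one_mul]⟩

lemma IsUnimodular.det_ne_zero {M : Matrix (Fin n) (Fin n) ℚ_[ℓ]} (hM : IsUnimodular M) :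
    M.det ≠ 0 := by
  intro h
  simpa [h] using hM.2

lemma IsUnimodular.isUnit_det {M : Matrix (Fin n) (Fin n) ℚ_[ℓ]} (hM : IsUnimodular M) :
    IsUnit M.det := isUnit_iff_ne_zero.2 hM.det_ne_zero

lemma IsUnimodular.inv {M : Matrix (Fin n) (Fin n) ℚ_[ℓ]} (hM : IsUnimodular M) :
    IsUnimodular M⁻¹ := by
  refine ⟨?_, by rw [Matrix.det_nonsing_inv, Ring.inverse_eq_inv', norm_inv, hM.2, inv_one]⟩
  rw [Matrix.inv_def, Ring.inverse_eq_inv']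
  refine IsIntegralMat.smul ?_ (by rw [norm_inv, hM.2, inv_one])
  obtain ⟨N, rfl⟩ := hM.1.exists_map
  rw [← RingHom.map_adjugate]
  exact isIntegralMat_map _

lemma IsUnimodular.smul {M : Matrix (Fin n) (Fin n) ℚ_[ℓ]} (hM : IsUnimodular M)
    {c : ℚ_[ℓ]} (hc : ‖c‖ = 1) : IsUnimodular (c • M) :=
  ⟨hM.1.smul hc.le, by rw [Matrix.det_smul, norm_mul, norm_pow, hc, hM.2, one_pow, one_mul]⟩

lemma IsUnimodular.transpose {M : Matrix (Fin n) (Fin n) ℚ_[ℓ]} (hM : IsUnimodular M) :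
    IsUnimodular Mᵀ := ⟨fun i j => hM.1 j i, by rw [Matrix.det_transpose, hM.2]⟩

lemma IsUnimodular.exists_isIntegralGL {M : Matrix (Fin n) (Fin n) ℚ_[ℓ]} (hM : IsUnimodular M) :
    ∃ k : GL (Fin n) ℚ_[ℓ], (k : Matrix (Fin n) (Fin n) ℚ_[ℓ]) = M ∧ IsIntegralGL ℓ k := by
  refine ⟨Matrix.GeneralLinearGroup.mkOfDetNeZero M hM.det_ne_zero, rfl, hM.1, ?_⟩
  rw [Matrix.coe_units_inv]
  exact hM.inv.1

lemma IsIntegralMat.norm_mulVec_le {M : Matrix (Fin n) (Fin n) ℚ_[ℓ]} (hM : IsIntegralMat M)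
    (v : Fin n → ℚ_[ℓ]) : ‖M *ᵥ v‖ ≤ ‖v‖ := by
  refine (pi_norm_le_iff_of_nonneg (norm_nonneg _)).2 fun i => ?_
  rw [Matrix.mulVec, dotProduct]
  refine IsUltrametricDist.norm_sum_le_of_forall_le_of_nonneg (f := fun j => M i j * v j)
    (norm_nonneg v) fun j _ => ?_
  rw [norm_mul]
  exact (mul_le_of_le_one_left (norm_nonneg _) (hM i j)).trans (norm_le_pi_norm v j)

lemma isIntegralMat_fin_two {a b c d : ℚ_[ℓ]} (ha : ‖a‖ ≤ 1) (hb : ‖b‖ ≤ 1) (hc : ‖c‖ ≤ 1)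
    (hd : ‖d‖ ≤ 1) : IsIntegralMat !![a, b; c, d] := by
  intro i j
  fin_cases i <;> fin_cases j <;> simpa

lemma isUnimodular_fin_two {a b c d : ℚ_[ℓ]} (ha : ‖a‖ ≤ 1) (hb : ‖b‖ ≤ 1) (hc : ‖c‖ ≤ 1)
    (hd : ‖d‖ ≤ 1) (h : ‖a * d - b * c‖ = 1) : IsUnimodular !![a, b; c, d] :=
  ⟨isIntegralMat_fin_two ha hb hc hd, by rwa [Matrix.det_fin_two_of]⟩

lemma cast_ne_zero_padic : (ℓ : ℚ_[ℓ]) ≠ 0 := Nat.cast_ne_zero.2 (Fact.out : ℓ.Prime).ne_zero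

lemma exists_unit_mul_zpow {x : ℚ_[ℓ]} (hx : x ≠ 0) :
    ∃ (ε : ℚ_[ℓ]) (m : ℤ), ‖ε‖ = 1 ∧ x = ε * (ℓ : ℚ_[ℓ]) ^ m := by
  have h := zpow_ne_zero x.valuation (cast_ne_zero_padic (ℓ := ℓ))
  refine ⟨x / (ℓ : ℚ_[ℓ]) ^ x.valuation, x.valuation, ?_, (div_mul_cancel₀ _ h).symm⟩
  rw [norm_div, Padic.norm_p_zpow, Padic.norm_eq_zpow_neg_valuation hx, div_self]
  exact zpow_ne_zero _ (Nat.cast_ne_zero.2 (Fact.out : ℓ.Prime).ne_zero)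

lemma norm_zpow_le_iff {m k : ℤ} : ‖(ℓ : ℚ_[ℓ]) ^ m‖ ≤ ‖(ℓ : ℚ_[ℓ]) ^ k‖ ↔ k ≤ m := by
  rw [Padic.norm_p_zpow, Padic.norm_p_zpow,
    zpow_le_zpow_iff_right₀ (by exact_mod_cast (Fact.out : ℓ.Prime).one_lt), neg_le_neg_iff]

lemma norm_zpow_le_one_iff {m : ℤ} : ‖(ℓ : ℚ_[ℓ]) ^ m‖ ≤ 1 ↔ 0 ≤ m := by
  simpa using norm_zpow_le_iff (ℓ := ℓ) (m := m) (k := 0)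

/-- The matrix of generators `(0, ℓ^d Y)`, `(X, Y)` of a lattice glued from two planar lattices. -/
def gluedMat (d : ℤ) (X Y : Matrix (Fin 2) (Fin 2) ℚ_[ℓ]) : Matrix (Fin 4) (Fin 4) ℚ_[ℓ] :=
  !![0, 0, X 0 0, X 0 1;
     (ℓ : ℚ_[ℓ]) ^ d * Y 0 0, (ℓ : ℚ_[ℓ]) ^ d * Y 0 1, Y 0 0, Y 0 1;
     (ℓ : ℚ_[ℓ]) ^ d * Y 1 0, (ℓ : ℚ_[ℓ]) ^ d * Y 1 1, Y 1 0, Y 1 1;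
     0, 0, X 1 0, X 1 1]

/-- The block matrix with diagonal blocks `V`, `W` and upper right block `T`. -/
def blockUpper (V T W : Matrix (Fin 2) (Fin 2) ℚ_[ℓ]) : Matrix (Fin 4) (Fin 4) ℚ_[ℓ] :=
  !![V 0 0, V 0 1, T 0 0, T 0 1;
     V 1 0, V 1 1, T 1 0, T 1 1;
     0, 0, W 0 0, W 0 1;
     0, 0, W 1 0, W 1 1]

lemma IsUnimodular.blockUpper {V T W : Matrix (Fin 2) (Fin 2) ℚ_[ℓ]} (hV : IsUnimodular V)
    (hT : IsIntegralMat T) (hW : IsUnimodular W) : IsUnimodular (blockUpper V T W) := by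
  constructor
  · intro i j
    fin_cases i <;> fin_cases j <;> simp [_root_.blockUpper, hV.1 _ _, hT _ _, hW.1 _ _]
  · have : (_root_.blockUpper V T W).det = V.det * W.det := by
      simp [_root_.blockUpper, Matrix.det_succ_row_zero, Fin.sum_univ_succ, Fin.succAbove]
      ring
    rw [this, norm_mul, hV.2, hW.2, one_mul]

/-- `g` lies in `ι(H(ℤ_ℓ)) 𝐠(μ',μ) GL₄(ℤ_ℓ)` for some `(μ',μ) ∈ Λ₀⁺⁺ × Λ⁺`. -/
def HasDecomposition (g : Matrix (Fin 4) (Fin 4) ℚ_[ℓ]) : Prop :=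
  ∃ μ' μ : Fin 3 → ℤ, InLambdaZeroPlusPlus μ' ∧ InLambdaPlus μ ∧
    ∃ h₁ h₂ : Matrix (Fin 2) (Fin 2) ℚ_[ℓ], h₁.det = h₂.det ∧ IsUnimodular h₁ ∧
      IsUnimodular h₂ ∧ ∃ k, IsUnimodular k ∧ g = iotaMat ℓ h₁ h₂ * gRep ℓ μ' μ * k

lemma HasDecomposition.mul_right {g k : Matrix (Fin 4) (Fin 4) ℚ_[ℓ]} (hg : HasDecomposition g)
    (hk : IsUnimodular k) : HasDecomposition (g * k) := by
  obtain ⟨μ', μ, hμ', hμ, h₁, h₂, hdet, hh₁, hh₂, k', hk', rfl⟩ := hg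
  exact ⟨μ', μ, hμ', hμ, h₁, h₂, hdet, hh₁, hh₂, k' * k, hk'.mul hk, Matrix.mul_assoc _ _ _⟩

lemma HasDecomposition.of_mul_right {g k : Matrix (Fin 4) (Fin 4) ℚ_[ℓ]} (hk : IsUnimodular k)
    (hg : HasDecomposition (g * k)) : HasDecomposition g := by
  simpa [Matrix.mul_assoc, Matrix.mul_nonsing_inv _ hk.isUnit_det] using hg.mul_right hk.inv

lemma HasDecomposition.of_gluedMat_mul {d : ℤ} {X Y U : Matrix (Fin 2) (Fin 2) ℚ_[ℓ]}
    (hU : IsUnimodular U) (h : HasDecomposition (gluedMat d (X * U) (Y * U))) :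
    HasDecomposition (gluedMat d X Y) := by
  refine .of_mul_right (hU.blockUpper (T := 0) (by intro i j; simp) hU) ?_
  convert h using 1
  ext i j
  fin_cases i <;> fin_cases j <;>
    simp [gluedMat, _root_.blockUpper, Matrix.mul_apply, Fin.sum_univ_four, Fin.sum_univ_two] <;>
    ring

lemma HasDecomposition.of_gluedMat_add {d : ℤ} (hd : 0 ≤ d)
    {X Y : Matrix (Fin 2) (Fin 2) ℚ_[ℓ]}
    (h : HasDecomposition (gluedMat d X (Y * !![1, 0; (ℓ : ℚ_[ℓ]) ^ d, 1]))) :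
    HasDecomposition (gluedMat d X Y) := by
  refine .of_mul_right (k := _root_.blockUpper !![1, 0; (ℓ : ℚ_[ℓ]) ^ d, 1] !![0, 0; 1, 0] 1)
    (.blockUpper ?_ ?_ .one) ?_
  · exact isUnimodular_fin_two (by simp) (by simp) (norm_zpow_le_one_iff.2 hd) (by simp) (by simp)
  · exact isIntegralMat_fin_two (by simp) (by simp) (by simp) (by simp)
  convert h using 1
  ext i j
  fin_cases i <;> fin_cases j <;>
    simp [gluedMat, _root_.blockUpper, Matrix.mul_apply, Fin.sum_univ_four, Fin.sum_univ_two] <;>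
    ring

lemma gRep_normalForm (A B B' C d : ℤ) :
    gRep ℓ ![0, B - (A - C + B'), B' + B - 2 * (A - C + B')]
      ![d + A, d + (A - C + B'), A + d + (A - C + B')] =
    !![(ℓ : ℚ_[ℓ]) ^ (d + A), (ℓ : ℚ_[ℓ]) ^ (d + B' - C + A), (ℓ : ℚ_[ℓ]) ^ A, 0;
       0, (ℓ : ℚ_[ℓ]) ^ (d + B), 0, (ℓ : ℚ_[ℓ]) ^ B;
       0, 0, (ℓ : ℚ_[ℓ]) ^ C, -(ℓ : ℚ_[ℓ]) ^ B';
       0, 0, 0, (ℓ : ℚ_[ℓ]) ^ (B + C - A)] := by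
  have hp := cast_ne_zero_padic (ℓ := ℓ)
  ext i j
  rw [gRep, tMat, tMat, Matrix.mul_diagonal, Matrix.diagonal_mul]
  fin_cases i <;> fin_cases j <;> simp [Bmat, ← zpow_add₀ hp] <;> congr 1 <;> ring

/-- The lattices in normal position are those of the representatives `𝐠(μ',μ)`. -/
lemma hasDecomposition_normalForm {A B B' C d : ℤ} (hBB : B' ≤ B) (hBC : B' ≤ C)
    (hCB : C ≤ d + B') {h₁ h₂ : Matrix (Fin 2) (Fin 2) ℚ_[ℓ]} (hh₁ : IsUnimodular h₁)
    (hh₂ : IsUnimodular h₂) (hdet : h₁.det = h₂.det) :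
    HasDecomposition (gluedMat d (h₁ * !![(ℓ : ℚ_[ℓ]) ^ A, 0; 0, (ℓ : ℚ_[ℓ]) ^ (B + C - A)])
      (h₂ * !![0, (ℓ : ℚ_[ℓ]) ^ B; (ℓ : ℚ_[ℓ]) ^ C, -(ℓ : ℚ_[ℓ]) ^ B'])) := by
  have hp := cast_ne_zero_padic (ℓ := ℓ)
  refine ⟨![0, B - (A - C + B'), B' + B - 2 * (A - C + B')],
    ![d + A, d + (A - C + B'), A + d + (A - C + B')], ⟨?_, ?_⟩, ⟨?_, ?_⟩, h₁, h₂, hdet, hh₁, hh₂,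
    !![-1, 0, 0, 0; 0, 1, 0, 0; (ℓ : ℚ_[ℓ]) ^ d, -(ℓ : ℚ_[ℓ]) ^ (d + B' - C), 1, 0; 0, 0, 0, 1],
    ⟨?_, ?_⟩, ?_⟩
  · simp
  · simp; omega
  · simp; omega
  · simp; omega
  · have h1 : ‖(ℓ : ℚ_[ℓ]) ^ d‖ ≤ 1 := norm_zpow_le_one_iff.2 (by omega)
    have h2 : ‖(ℓ : ℚ_[ℓ]) ^ (d + B' - C)‖ ≤ 1 := norm_zpow_le_one_iff.2 (by omega)
    generalize (ℓ : ℚ_[ℓ]) ^ d = x at h1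
    generalize (ℓ : ℚ_[ℓ]) ^ (d + B' - C) = y at h2
    intro i j
    fin_cases i <;> fin_cases j <;> simp [h1, h2]
  · simp [Matrix.det_succ_row_zero, Fin.sum_univ_succ, Fin.succAbove]
  · rw [gRep_normalForm]
    have h1 : (ℓ : ℚ_[ℓ]) ^ (d + B' - C) * (ℓ : ℚ_[ℓ]) ^ C = (ℓ : ℚ_[ℓ]) ^ d * (ℓ : ℚ_[ℓ]) ^ B' := by
      rw [← zpow_add₀ hp, ← zpow_add₀ hp]
      congr 1
      ring
    rw [zpow_add₀ hp d A, zpow_add₀ hp d B, zpow_add₀ hp (d + B' - C) A]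
    generalize (ℓ : ℚ_[ℓ]) ^ (d + B' - C) = e at *
    ext i j
    fin_cases i <;> fin_cases j <;>
      simp [gluedMat, iotaMat, Matrix.mul_apply, Fin.sum_univ_four, Fin.sum_univ_two] <;>
      first
      | ring1
      | linear_combination h₂ 0 1 * h1
      | linear_combination h₂ 1 1 * h1

lemma IsUnimodular.norm_mulVec {M : Matrix (Fin n) (Fin n) ℚ_[ℓ]} (hM : IsUnimodular M)
    (v : Fin n → ℚ_[ℓ]) : ‖M *ᵥ v‖ = ‖v‖ := by
  refine le_antisymm (hM.1.norm_mulVec_le v) ?_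
  simpa [Matrix.mulVec_mulVec, Matrix.nonsing_inv_mul _ hM.isUnit_det] using
    hM.inv.1.norm_mulVec_le (M *ᵥ v)

lemma norm_div_le_one {x y : ℚ_[ℓ]} (h : ‖x‖ ≤ ‖y‖) : ‖x / y‖ ≤ 1 := by
  rw [norm_div]
  exact div_le_one_of_le₀ h (norm_nonneg _)

lemma zpow_ne_zero_padic (m : ℤ) : (ℓ : ℚ_[ℓ]) ^ m ≠ 0 := zpow_ne_zero m cast_ne_zero_padic

lemma norm_unit_mul {ε x : ℚ_[ℓ]} (h : ‖ε‖ = 1) : ‖ε * x‖ = ‖x‖ := by rw [norm_mul, h, one_mul]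

/-- A nonzero planar vector is a scalar multiple of the second column of a unimodular matrix. -/
lemma exists_isUnimodular_col {a b : ℚ_[ℓ]} (h : a ≠ 0 ∨ b ≠ 0) :
    ∃ (P : Matrix (Fin 2) (Fin 2) ℚ_[ℓ]) (C : ℤ), IsUnimodular P ∧
      a = P 0 1 * (ℓ : ℚ_[ℓ]) ^ C ∧ b = P 1 1 * (ℓ : ℚ_[ℓ]) ^ C := by
  rcases le_total ‖a‖ ‖b‖ with hab | hab
  · have hb : b ≠ 0 := by
      rintro rfl
      simp_all
    obtain ⟨ε, C, hε, rfl⟩ := exists_unit_mul_zpow hb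
    rw [norm_unit_mul hε] at hab
    refine ⟨!![1, a / (ℓ : ℚ_[ℓ]) ^ C; 0, ε], C, isUnimodular_fin_two (by simp)
      (norm_div_le_one hab) (by simp) hε.le (by simpa), ?_, by simp⟩
    simp [zpow_ne_zero_padic]
  · have ha : a ≠ 0 := by
      rintro rfl
      simp_all
    obtain ⟨ε, C, hε, rfl⟩ := exists_unit_mul_zpow ha
    rw [norm_unit_mul hε] at hab
    refine ⟨!![0, ε; 1, b / (ℓ : ℚ_[ℓ]) ^ C], C, isUnimodular_fin_two (by simp)
      hε.le (by simp) (norm_div_le_one hab) (by simpa), by simp, ?_⟩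
    simp [zpow_ne_zero_padic]

/-- Up to a unimodular matrix on the left and a unit, the columns of an invertible planar matrix
are `ℓ^C e₂` and `ℓ^B e₁ - ℓ^{B'} e₂`. -/
lemma exists_column_normalForm {Y : Matrix (Fin 2) (Fin 2) ℚ_[ℓ]} (hY : Y.det ≠ 0) :
    ∃ (P : Matrix (Fin 2) (Fin 2) ℚ_[ℓ]) (ε : ℚ_[ℓ]) (B B' C : ℤ), IsUnimodular P ∧ ‖ε‖ = 1 ∧
      B' ≤ B ∧ Y * !![ε, 0; 0, 1] =
        P * !![0, (ℓ : ℚ_[ℓ]) ^ B; (ℓ : ℚ_[ℓ]) ^ C, -(ℓ : ℚ_[ℓ]) ^ B'] := by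
  obtain ⟨P, C, hP, h0, h1⟩ := exists_isUnimodular_col (a := Y 0 0) (b := Y 1 0) (by
    by_contra! h
    simp [Matrix.det_fin_two, h] at hY)
  obtain ⟨s, r, hs, hr⟩ : ∃ s r, Y 0 1 = P 0 0 * s + P 0 1 * r ∧ Y 1 1 = P 1 0 * s + P 1 1 * r := by
    have h : P *ᵥ (P⁻¹ *ᵥ ![Y 0 1, Y 1 1]) = ![Y 0 1, Y 1 1] := by
      rw [Matrix.mulVec_mulVec, Matrix.mul_nonsing_inv _ hP.isUnit_det, Matrix.one_mulVec]
    refine ⟨(P⁻¹ *ᵥ ![Y 0 1, Y 1 1]) 0, (P⁻¹ *ᵥ ![Y 0 1, Y 1 1]) 1, ?_, ?_⟩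
    · simpa [Matrix.mulVec, dotProduct, Fin.sum_univ_two] using (congrFun h 0).symm
    · simpa [Matrix.mulVec, dotProduct, Fin.sum_univ_two] using (congrFun h 1).symm
  have hs0 : s ≠ 0 := by
    rintro rfl
    apply hY
    rw [Matrix.det_fin_two, h0, h1, hs, hr]
    ring
  obtain ⟨η, B, hη, rfl⟩ := exists_unit_mul_zpow hs0
  rcases le_or_gt ‖η * (ℓ : ℚ_[ℓ]) ^ B‖ ‖r‖ with hle | hlt
  · have hr0 : r ≠ 0 := by
      rintro rfl
      rw [norm_zero, norm_le_zero_iff] at hle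
      exact hs0 hle
    obtain ⟨ρ, B', hρ, rfl⟩ := exists_unit_mul_zpow hr0
    rw [norm_unit_mul hη, norm_unit_mul hρ, norm_zpow_le_iff] at hle
    refine ⟨P * !![η, 0; 0, -ρ], -ρ, B, B', C,
      hP.mul (isUnimodular_fin_two hη.le (by simp) (by simp) (by simp [hρ]) (by simp [hρ, hη])),
      by simpa, hle, ?_⟩
    ext i j
    fin_cases i <;> fin_cases j <;>
      simp [Matrix.mul_apply, Fin.sum_univ_two, h0, h1, hs, hr] <;> ring
  · rw [norm_unit_mul hη] at hlt
    refine ⟨P * !![η, 0; r / (ℓ : ℚ_[ℓ]) ^ B + 1, 1], 1, B, B, C,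
      hP.mul (isUnimodular_fin_two hη.le (by simp)
        (norm_add_le_one (norm_div_le_one hlt.le) (by simp)) (by simp) (by simpa)),
      by simp, le_rfl, ?_⟩
    have := zpow_ne_zero_padic (ℓ := ℓ) B
    ext i j
    fin_cases i <;> fin_cases j <;>
      simp [Matrix.mul_apply, Fin.sum_univ_two, h0, h1, hs, hr] <;> field_simp <;> ring

lemma exists_smith_of_le {X : Matrix (Fin 2) (Fin 2) ℚ_[ℓ]} (hX : X.det ≠ 0)
    (h : ∀ i j, ‖X i j‖ ≤ ‖X 1 1‖) :
    ∃ (P U : Matrix (Fin 2) (Fin 2) ℚ_[ℓ]) (A D : ℤ), IsUnimodular P ∧ IsUnimodular U ∧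
      D ≤ A ∧ X * U = P * !![(ℓ : ℚ_[ℓ]) ^ A, 0; 0, (ℓ : ℚ_[ℓ]) ^ D] := by
  have hs : X 1 1 ≠ 0 := by
    intro h0
    apply hX
    simp only [h0, norm_zero, norm_le_zero_iff] at h
    rw [Matrix.det_fin_two, h 0 0, h 0 1]
    ring
  have ha : X 0 0 - X 0 1 * (X 1 0 / X 1 1) ≠ 0 := by
    intro h0
    apply hX
    rw [Matrix.det_fin_two]
    field_simp at h0
    linear_combination h0
  obtain ⟨η, D, hη, hD⟩ := exists_unit_mul_zpow hs
  obtain ⟨α, A, hα, hA⟩ := exists_unit_mul_zpow ha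
  have hsD : ‖X 1 1‖ = ‖(ℓ : ℚ_[ℓ]) ^ D‖ := by rw [hD, norm_unit_mul hη]
  have hAD : ‖(ℓ : ℚ_[ℓ]) ^ A‖ ≤ ‖(ℓ : ℚ_[ℓ]) ^ D‖ := by
    rw [← norm_unit_mul hα, ← hA, ← hsD, sub_eq_add_neg]
    refine (IsUltrametricDist.norm_add_le_max _ _).trans (max_le (h 0 0) ?_)
    rw [norm_neg, norm_mul]
    exact (mul_le_of_le_one_right (norm_nonneg _) (norm_div_le_one (h 1 0))).trans (h 0 1)
  refine ⟨!![α, X 0 1 / (ℓ : ℚ_[ℓ]) ^ D; 0, η], !![1, 0; -(X 1 0 / X 1 1), 1], A, D,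
    isUnimodular_fin_two hα.le (norm_div_le_one (hsD ▸ h 0 1)) (by simp) hη.le (by simp [hα, hη]),
    isUnimodular_fin_two (by simp) (by simp) ?_ (by simp) (by simp), norm_zpow_le_iff.1 hAD, ?_⟩
  · rw [norm_neg]
    exact norm_div_le_one (h 1 0)
  · have := zpow_ne_zero_padic (ℓ := ℓ) D
    ext i j
    fin_cases i <;> fin_cases j <;> simp [Matrix.mul_apply, Fin.sum_univ_two, ← hA, ← hD]
    · ring
    · field_simp
    · field_simp
      ring

/-- The Cartan decomposition of `GL₂(ℚ_ℓ)`. -/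
lemma exists_smith {X : Matrix (Fin 2) (Fin 2) ℚ_[ℓ]} (hX : X.det ≠ 0) :
    ∃ (P U : Matrix (Fin 2) (Fin 2) ℚ_[ℓ]) (A D : ℤ), IsUnimodular P ∧ IsUnimodular U ∧
      D ≤ A ∧ X * U = P * !![(ℓ : ℚ_[ℓ]) ^ A, 0; 0, (ℓ : ℚ_[ℓ]) ^ D] := by
  have hw : ∀ i : Fin 2, ∃ w : Matrix (Fin 2) (Fin 2) ℚ_[ℓ], IsUnimodular w ∧ w * w = 1 ∧
      ∀ Z : Matrix (Fin 2) (Fin 2) ℚ_[ℓ], (∀ j k, ∃ j', (w * Z) j k = Z j' k) ∧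
        (∀ j k, ∃ k', (Z * w) j k = Z j k') ∧ (∀ k, (w * Z) 1 k = Z i k) ∧
        (∀ k, (Z * w) k 1 = Z k i) := by
    intro i
    fin_cases i
    · refine ⟨!![0, 1; 1, 0], isUnimodular_fin_two (by simp) (by simp) (by simp) (by simp)
        (by simp), by simp [Matrix.one_fin_two], fun Z => ⟨fun j k => ⟨1 - j, ?_⟩,
        fun j k => ⟨1 - k, ?_⟩, fun k => ?_, fun k => ?_⟩⟩
      · fin_cases j <;> simp [Matrix.mul_apply, Fin.sum_univ_two]
      · fin_cases k <;> simp [Matrix.mul_apply, Fin.sum_univ_two]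
      · simp [Matrix.mul_apply, Fin.sum_univ_two]
      · simp [Matrix.mul_apply, Fin.sum_univ_two]
    · exact ⟨1, .one, by simp, fun Z => ⟨fun j k => ⟨j, by simp⟩, fun j k => ⟨k, by simp⟩,
        by simp, by simp⟩⟩
  obtain ⟨⟨i, j⟩, hij⟩ := Finite.exists_max fun q : Fin 2 × Fin 2 => ‖X q.1 q.2‖
  obtain ⟨v, hv, hvv, hvX⟩ := hw i
  obtain ⟨w, hwu, hww, hwX⟩ := hw j
  obtain ⟨P, U, A, D, hP, hU, hAD, h⟩ := exists_smith_of_le (X := v * X * w) (by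
      rw [Matrix.det_mul, Matrix.det_mul]
      exact mul_ne_zero (mul_ne_zero hv.det_ne_zero hX) hwu.det_ne_zero) (by
      intro a b
      obtain ⟨b', hb⟩ := (hwX (v * X)).2.1 a b
      obtain ⟨a', ha⟩ := (hvX X).1 a b'
      rw [(hwX (v * X)).2.2.2, (hvX X).2.2.1, hb, ha]
      exact hij (a', b'))
  refine ⟨v * P, w * U, A, D, hv.mul hP, hwu.mul hU, hAD, ?_⟩
  rw [Matrix.mul_assoc v, ← h]
  simp only [← Matrix.mul_assoc, hvv, Matrix.one_mul]

lemma hasDecomposition_of_content_le {A D d : ℤ} {h Y : Matrix (Fin 2) (Fin 2) ℚ_[ℓ]}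
    (hh : IsUnimodular h)
    (hdet : (h * !![(ℓ : ℚ_[ℓ]) ^ A, 0; 0, (ℓ : ℚ_[ℓ]) ^ D]).det = -Y.det)
    (hle : ‖Y *ᵥ ![1, 0]‖ ≤ ‖Y *ᵥ ![0, 1]‖)
    (hge : ‖(ℓ : ℚ_[ℓ]) ^ d‖ * ‖Y *ᵥ ![0, 1]‖ ≤ ‖Y *ᵥ ![1, 0]‖) :
    HasDecomposition (gluedMat d (h * !![(ℓ : ℚ_[ℓ]) ^ A, 0; 0, (ℓ : ℚ_[ℓ]) ^ D]) Y) := by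
  have hp := cast_ne_zero_padic (ℓ := ℓ)
  have hY : Y.det ≠ 0 := by
    rw [← neg_ne_zero, ← hdet, Matrix.det_mul, Matrix.det_fin_two_of]
    exact mul_ne_zero hh.det_ne_zero (by simp [zpow_ne_zero_padic])
  obtain ⟨P, ε, B, B', C, hP, hε, hBB, hYP⟩ := exists_column_normalForm hY
  have hε0 : ε ≠ 0 := by
    rintro rfl
    simp at hε
  have hU : IsUnimodular !![ε, 0; 0, 1] :=
    isUnimodular_fin_two hε.le (by simp) (by simp) (by simp) (by simpa)
  have hnorm : ∀ v, ‖Y *ᵥ (!![ε, 0; 0, 1] *ᵥ v)‖ =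
      ‖!![0, (ℓ : ℚ_[ℓ]) ^ B; (ℓ : ℚ_[ℓ]) ^ C, -(ℓ : ℚ_[ℓ]) ^ B'] *ᵥ v‖ := fun v => by
    rw [Matrix.mulVec_mulVec, hYP, ← Matrix.mulVec_mulVec, hP.norm_mulVec]
  have hC : ‖Y *ᵥ ![1, 0]‖ = ‖(ℓ : ℚ_[ℓ]) ^ C‖ := by
    have h0 := hnorm ![1, 0]
    have h1 : !![ε, 0; 0, 1] *ᵥ ![1, 0] = ε • ![1, 0] := by
      ext i; fin_cases i <;> simp [Matrix.mulVec, dotProduct]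
    rw [h1, Matrix.mulVec_smul, norm_smul, hε, one_mul] at h0
    rw [h0, Pi.norm_def]
    simp [Matrix.mulVec, dotProduct, Fin.univ_succ, -norm_zpow, -nnnorm_zpow]
  have hB : ‖Y *ᵥ ![0, 1]‖ = ‖(ℓ : ℚ_[ℓ]) ^ B'‖ := by
    have h0 := hnorm ![0, 1]
    have h1 : !![ε, 0; 0, 1] *ᵥ ![0, 1] = ![0, 1] := by
      ext i; fin_cases i <;> simp [Matrix.mulVec, dotProduct]
    rw [h1] at h0
    rw [h0]
    have h2 : !![0, (ℓ : ℚ_[ℓ]) ^ B; (ℓ : ℚ_[ℓ]) ^ C, -(ℓ : ℚ_[ℓ]) ^ B'] *ᵥ ![0, 1] =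
        ![(ℓ : ℚ_[ℓ]) ^ B, -(ℓ : ℚ_[ℓ]) ^ B'] := by
      ext i; fin_cases i <;> simp [Matrix.mulVec, dotProduct]
    have hBB' := norm_zpow_le_iff (ℓ := ℓ).2 hBB
    rw [h2]
    refine le_antisymm ((pi_norm_le_iff_of_nonneg (norm_nonneg _)).2 fun i => ?_) ?_
    · fin_cases i
      · exact hBB'
      · exact (norm_neg _).le
    · rw [← norm_neg]
      exact norm_le_pi_norm ![(ℓ : ℚ_[ℓ]) ^ B, -(ℓ : ℚ_[ℓ]) ^ B'] 1
  rw [hB, hC, norm_zpow_le_iff] at hle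
  rw [hB, hC, ← norm_mul, ← zpow_add₀ hp, norm_zpow_le_iff] at hge
  have hYdet := congrArg Matrix.det hYP
  rw [Matrix.det_mul, Matrix.det_mul, Matrix.det_fin_two_of, Matrix.det_fin_two_of] at hYdet
  rw [Matrix.det_mul, Matrix.det_fin_two_of] at hdet
  have key : h.det * ε * (ℓ : ℚ_[ℓ]) ^ (A + D) = P.det * (ℓ : ℚ_[ℓ]) ^ (B + C) := by
    rw [zpow_add₀ hp, zpow_add₀ hp]
    linear_combination ε * hdet - hYdet
  have hnorms : ‖(ℓ : ℚ_[ℓ]) ^ (A + D)‖ = ‖(ℓ : ℚ_[ℓ]) ^ (B + C)‖ := by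
    simpa only [norm_mul, hh.2, hP.2, hε, one_mul] using congrArg norm key
  obtain rfl : D = B + C - A := by
    have h1 := norm_zpow_le_iff.1 hnorms.le
    have h2 := norm_zpow_le_iff.1 hnorms.ge
    omega
  refine .of_gluedMat_mul hU ?_
  have hX : h * !![(ℓ : ℚ_[ℓ]) ^ A, 0; 0, (ℓ : ℚ_[ℓ]) ^ (B + C - A)] * !![ε, 0; 0, 1] =
      h * !![ε, 0; 0, 1] * !![(ℓ : ℚ_[ℓ]) ^ A, 0; 0, (ℓ : ℚ_[ℓ]) ^ (B + C - A)] := by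
    rw [Matrix.mul_assoc, Matrix.mul_assoc]
    congr 1
    simp [mul_comm]
  rw [hX, hYP]
  refine hasDecomposition_normalForm hBB hle hge (hh.mul hU) hP ?_
  rw [Matrix.det_mul, Matrix.det_fin_two_of]
  rw [add_sub_cancel] at key
  simpa using mul_right_cancel₀ (zpow_ne_zero_padic _) key

lemma hasDecomposition_of_le {A D d : ℤ} (hd : 0 ≤ d) {h Y : Matrix (Fin 2) (Fin 2) ℚ_[ℓ]}
    (hh : IsUnimodular h)
    (hdet : (h * !![(ℓ : ℚ_[ℓ]) ^ A, 0; 0, (ℓ : ℚ_[ℓ]) ^ D]).det = -Y.det)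
    (hle : ‖Y *ᵥ ![1, 0]‖ ≤ ‖Y *ᵥ ![0, 1]‖) :
    HasDecomposition (gluedMat d (h * !![(ℓ : ℚ_[ℓ]) ^ A, 0; 0, (ℓ : ℚ_[ℓ]) ^ D]) Y) := by
  rcases le_or_gt (‖(ℓ : ℚ_[ℓ]) ^ d‖ * ‖Y *ᵥ ![0, 1]‖) ‖Y *ᵥ ![1, 0]‖ with hge | hlt
  · exact hasDecomposition_of_content_le hh hdet hle hge
  refine .of_gluedMat_add hd ?_
  have h0 : (Y * !![1, 0; (ℓ : ℚ_[ℓ]) ^ d, 1]) *ᵥ ![1, 0] =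
      Y *ᵥ ![1, 0] + (ℓ : ℚ_[ℓ]) ^ d • (Y *ᵥ ![0, 1]) := by
    ext i; fin_cases i <;> simp [Matrix.mulVec, dotProduct, Matrix.mul_apply] <;> ring
  have h1 : (Y * !![1, 0; (ℓ : ℚ_[ℓ]) ^ d, 1]) *ᵥ ![0, 1] = Y *ᵥ ![0, 1] := by
    ext i; fin_cases i <;> simp [Matrix.mulVec, dotProduct, Matrix.mul_apply]
  rw [← norm_smul] at hlt
  have h2 : ‖(Y * !![1, 0; (ℓ : ℚ_[ℓ]) ^ d, 1]) *ᵥ ![1, 0]‖ =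
      ‖(ℓ : ℚ_[ℓ]) ^ d‖ * ‖Y *ᵥ ![0, 1]‖ := by
    rw [h0, IsUltrametricDist.norm_add_eq_max_of_norm_ne_norm hlt.ne, max_eq_right hlt.le,
      norm_smul]
  refine hasDecomposition_of_content_le hh ?_ ?_ ?_
  · rw [hdet, Matrix.det_mul, Matrix.det_fin_two_of]
    ring
  · rw [h2, h1]
    exact mul_le_of_le_one_left (norm_nonneg _) (norm_zpow_le_one_iff.2 hd)
  · rw [h2, h1]

lemma hasDecomposition_of_diagonal {A D d : ℤ} (hDA : D ≤ A) (hd : 0 ≤ d)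
    {h Y : Matrix (Fin 2) (Fin 2) ℚ_[ℓ]} (hh : IsUnimodular h)
    (hdet : (h * !![(ℓ : ℚ_[ℓ]) ^ A, 0; 0, (ℓ : ℚ_[ℓ]) ^ D]).det = -Y.det) :
    HasDecomposition (gluedMat d (h * !![(ℓ : ℚ_[ℓ]) ^ A, 0; 0, (ℓ : ℚ_[ℓ]) ^ D]) Y) := by
  rcases le_or_gt ‖Y *ᵥ ![1, 0]‖ ‖Y *ᵥ ![0, 1]‖ with hle | hlt
  · exact hasDecomposition_of_le hd hh hdet hle
  have hU : IsUnimodular !![1, (1 : ℚ_[ℓ]); 0, 1] :=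
    isUnimodular_fin_two (by simp) (by simp) (by simp) (by simp) (by simp)
  have hV : IsUnimodular !![1, (ℓ : ℚ_[ℓ]) ^ (A - D); 0, 1] :=
    isUnimodular_fin_two (by simp) (norm_zpow_le_one_iff.2 (by omega)) (by simp) (by simp)
      (by simp)
  refine .of_gluedMat_mul hU ?_
  have hX : h * !![(ℓ : ℚ_[ℓ]) ^ A, 0; 0, (ℓ : ℚ_[ℓ]) ^ D] * !![1, 1; 0, 1] =
      h * !![1, (ℓ : ℚ_[ℓ]) ^ (A - D); 0, 1] * !![(ℓ : ℚ_[ℓ]) ^ A, 0; 0, (ℓ : ℚ_[ℓ]) ^ D] := by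
    rw [Matrix.mul_assoc, Matrix.mul_assoc]
    congr 1
    simp [← zpow_add₀ cast_ne_zero_padic]
  have h0 : (Y * !![1, 1; 0, 1]) *ᵥ ![1, 0] = Y *ᵥ ![1, 0] := by
    ext i; fin_cases i <;> simp [Matrix.mulVec, dotProduct, Matrix.mul_apply]
  have h1 : (Y * !![1, 1; 0, 1]) *ᵥ ![0, 1] = Y *ᵥ ![1, 0] + Y *ᵥ ![0, 1] := by
    ext i; fin_cases i <;> simp [Matrix.mulVec, dotProduct, Matrix.mul_apply]
  rw [hX]
  refine hasDecomposition_of_le hd (hh.mul hV) ?_ ?_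
  · rw [← hX, Matrix.det_mul, hdet, Matrix.det_mul]
    ring
  · rw [h0, h1, IsUltrametricDist.norm_add_eq_max_of_norm_ne_norm hlt.ne']
    exact le_max_left _ _

lemma hasDecomposition_gluedMat {d : ℤ} (hd : 0 ≤ d) {X Y : Matrix (Fin 2) (Fin 2) ℚ_[ℓ]}
    (hX : X.det ≠ 0) (hdet : X.det = -Y.det) : HasDecomposition (gluedMat d X Y) := by
  obtain ⟨P, U, A, D, hP, hU, hDA, h⟩ := exists_smith hX
  refine .of_gluedMat_mul hU ?_
  rw [h]
  refine hasDecomposition_of_diagonal hDA hd hP ?_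
  rw [← h, Matrix.det_mul, hdet, Matrix.det_mul]
  ring

lemma exists_pivot {s : Finset (Fin n)} {j : Fin n} (hj : j ∈ s) (v : Fin n → ℚ_[ℓ]) :
    ∃ k : Matrix (Fin n) (Fin n) ℚ_[ℓ], IsUnimodular k ∧ (∀ i ∈ s, i ≠ j → (v ᵥ* k) i = 0) ∧
      ∀ w : Fin n → ℚ_[ℓ], (∀ i ∈ s, w i = 0) → w ᵥ* k = w := by
  obtain ⟨m, hm, hmax⟩ := s.exists_max_image (fun i => ‖v i‖) ⟨j, hj⟩
  let σ := Equiv.swap m j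
  have hσ : ∀ i ∈ s, σ i ∈ s := fun i hi => by
    simp only [σ, Equiv.swap_apply_def]
    split_ifs <;> assumption
  let c : Fin n → ℚ_[ℓ] := fun b => if b ∈ s ∧ b ≠ j then v (σ b) / v m else 0
  have hc : ∀ b, ‖c b‖ ≤ 1 := fun b => by
    simp only [c]
    split_ifs with h
    · exact norm_div_le_one (hmax _ (hσ b h.1))
    · simp
  have hP : IsUnimodular ((1 : Matrix (Fin n) (Fin n) ℚ_[ℓ]).submatrix id σ) := by
    refine ⟨fun a b => IsUnimodular.one.1 a (σ b), ?_⟩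
    rw [Matrix.det_permute', Matrix.det_one, mul_one]
    rcases Int.units_eq_one_or σ.sign with h | h <;> simp [h]
  have hE : IsUnimodular (1 - vecMulVec (Pi.single j 1) c) := by
    refine ⟨IsUnimodular.one.1.sub fun a b => ?_, ?_⟩
    · rw [Matrix.vecMulVec_apply, Pi.single_apply]
      split_ifs <;> simp [hc b]
    · rw [Matrix.vecMulVec_eq Unit, Matrix.det_one_sub_mul_comm]
      simp [c]
  have hvP : ∀ w : Fin n → ℚ_[ℓ], w ᵥ* (1 : Matrix (Fin n) (Fin n) ℚ_[ℓ]).submatrix id σ = w ∘ σ :=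
    fun w => by
      ext i
      simp [Matrix.vecMul, dotProduct, Matrix.one_apply]
  have hvE : ∀ (w : Fin n → ℚ_[ℓ]) i,
      (w ᵥ* (1 - vecMulVec (Pi.single j 1) c)) i = w i - w j * c i := fun w i => by
    simp [Matrix.vecMul_sub, Matrix.vecMul_vecMulVec]
  refine ⟨_, hP.mul hE, fun i hi hij => ?_, fun w hw => ?_⟩
  · rw [← Matrix.vecMul_vecMul, hvP, hvE]
    rcases eq_or_ne (v m) 0 with h0 | h0
    · have : v (σ i) = 0 := by simpa [h0] using hmax _ (hσ i hi)
      simp [this, σ, h0]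
    · simp [c, hi, hij, σ, mul_div_cancel₀, h0]
  · rw [← Matrix.vecMul_vecMul, hvP]
    have hwσ : w ∘ σ = w := by
      ext i
      simp only [Function.comp_apply, σ, Equiv.swap_apply_def]
      split_ifs with h1 h2
      · rw [h1, hw _ hj, hw _ hm]
      · rw [h2, hw _ hj, hw _ hm]
      · rfl
    ext i
    rw [hwσ, hvE, hw _ hj, zero_mul, sub_zero]

lemma det_smul_eq_mul_symplectic_transpose (Y Z : Matrix (Fin 2) (Fin 2) ℚ_[ℓ]) :
    Y.det • Z = Y * (!![0, 1; -1, 0] * (Zᵀ * !![0, 1; -1, 0] * Y)ᵀ) := by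
  ext i j
  fin_cases i <;> fin_cases j <;>
    simp [Matrix.mul_apply, Matrix.vecMul, Fin.sum_univ_two, Matrix.det_fin_two, dotProduct] <;> ring

lemma det_smul_eq_mul_symplectic (Y Z : Matrix (Fin 2) (Fin 2) ℚ_[ℓ]) :
    Z.det • Y = Z * (!![0, -1; 1, 0] * (Zᵀ * !![0, 1; -1, 0] * Y)) := by
  ext i j
  fin_cases i <;> fin_cases j <;>
    simp [Matrix.mul_apply, Matrix.vecMul, Fin.sum_univ_two, Matrix.det_fin_two, dotProduct] <;> ring

/-- Two generating blocks `Z`, `Y` of a lattice with integral Gram matrix can be glued along a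
common planar lattice. -/
lemma exists_gluing {X Y Z W : Matrix (Fin 2) (Fin 2) ℚ_[ℓ]} {u α β : ℚ_[ℓ]} (hα : ‖α‖ ≤ 1)
    (hβ : ‖β‖ ≤ 1) (hW : IsIntegralMat W) (hu : u ≠ 0) (hZ : Z.det = u * α)
    (hZY : Zᵀ * !![0, 1; -1, 0] * Y = u • W) (hXY : X.det + Y.det = u * β)
    (hXZ : ‖X.det * Z.det‖ = ‖u‖ ^ 2) :
    ∃ (d : ℤ) (Y' V T : Matrix (Fin 2) (Fin 2) ℚ_[ℓ]), 0 ≤ d ∧ IsUnimodular V ∧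
      IsIntegralMat T ∧ X.det = -Y'.det ∧ Z = (ℓ : ℚ_[ℓ]) ^ d • (Y' * V) ∧
      Y = Y' + (ℓ : ℚ_[ℓ]) ^ d • (Y' * T) := by
  have hu' : ‖u‖ ≠ 0 := norm_ne_zero_iff.2 hu
  have hXZ0 : X.det * Z.det ≠ 0 := by
    rw [← norm_ne_zero_iff, hXZ]
    exact pow_ne_zero 2 hu'
  have hX0 := left_ne_zero_of_mul hXZ0
  have hZ0 := right_ne_zero_of_mul hXZ0
  have hα0 : α ≠ 0 := by
    rintro rfl
    simp [hZ] at hZ0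
  have hW' : Z.det * Y.det = u ^ 2 * W.det := by
    have h := congrArg Matrix.det hZY
    rw [Matrix.det_mul, Matrix.det_mul, Matrix.det_transpose, Matrix.det_fin_two_of,
      Matrix.det_smul, Fintype.card_fin] at h
    linear_combination h
  have hpf : ‖α * β - W.det‖ = 1 := by
    have h : u ^ 2 * (α * β - W.det) = X.det * Z.det := by
      linear_combination -α * u * hXY + hW' - (X.det + Y.det) * hZ
    rw [← h, norm_mul, norm_pow] at hXZ
    exact mul_left_cancel₀ (pow_ne_zero 2 hu') (hXZ.trans (mul_one _).symm)
  by_cases hw : ‖W.det‖ = 1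
  · have hw0 : W.det ≠ 0 := by
      intro h
      simp [h] at hw
    obtain ⟨ε, d, hε, hd⟩ := exists_unit_mul_zpow hα0
    have hd0 : 0 ≤ d := by rwa [hd, norm_unit_mul hε, norm_zpow_le_one_iff] at hα
    have hY : α * Y.det = u * W.det := by
      apply mul_left_cancel₀ hu
      linear_combination hW' - Y.det * hZ
    obtain ⟨δ, hδ⟩ : ∃ δ, δ = 1 - α * β / W.det := ⟨_, rfl⟩
    have hδ1 : ‖δ‖ = 1 := by
      rw [hδ, one_sub_div hw0, norm_div, hw, div_one, norm_sub_rev, hpf]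
    have hδ0 : δ ≠ 0 := by
      rintro rfl
      simp at hδ1
    have hXδ : X.det = -(Y.det * δ) := by
      rw [hδ]
      field_simp
      linear_combination W.det * hXY - β * hY
    have hV : IsUnimodular (W.det⁻¹ • (!![0, 1; -1, 0] * Wᵀ)) := by
      refine .smul (.mul (isUnimodular_fin_two ?_ ?_ ?_ ?_ ?_) ?_) ?_
      · simp
      · simp
      · simp
      · simp
      · simp
      · exact IsUnimodular.transpose ⟨hW, hw⟩
      · rw [norm_inv, hw, inv_one]
    have hZV : Z = α • (Y * (W.det⁻¹ • (!![0, 1; -1, 0] * Wᵀ))) := by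
      have h : Y.det • Z = u • (Y * (!![0, 1; -1, 0] * Wᵀ)) := by
        rw [← Matrix.mul_smul, ← Matrix.mul_smul, ← Matrix.transpose_smul, ← hZY,
          det_smul_eq_mul_symplectic_transpose]
      have h2 : (u * W.det) • Z = (u * α) • (Y * (!![0, 1; -1, 0] * Wᵀ)) := by
        rw [← hY, mul_smul, h, smul_smul, mul_comm]
      rw [Matrix.mul_smul, smul_smul, ← smul_right_injective _ (mul_ne_zero hu hw0) |>.eq_iff]
      simp only [h2, smul_smul]
      congr 1
      field_simp
    refine ⟨d, Y * !![δ, 0; 0, 1],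
      ε • (!![δ⁻¹, 0; 0, 1] * (W.det⁻¹ • (!![0, 1; -1, 0] * Wᵀ))),
      !![ε * β / (W.det * δ), 0; 0, 0], hd0, ?_, ?_, ?_, ?_, ?_⟩
    · refine .smul (.mul (isUnimodular_fin_two ?_ ?_ ?_ ?_ ?_) hV) hε <;> simp [hδ1]
    · refine isIntegralMat_fin_two ?_ ?_ ?_ ?_ <;> simp [hδ1, hε, hw, hβ]
    · rw [Matrix.det_mul, Matrix.det_fin_two_of, hXδ]
      ring
    · have h : !![δ, 0; 0, 1] * !![δ⁻¹, 0; 0, 1] = 1 := by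
        simp [hδ0, Matrix.one_fin_two]
      rw [Matrix.mul_smul, ← Matrix.mul_assoc, Matrix.mul_assoc Y, smul_smul, mul_comm _ ε, ← hd,
        h, Matrix.mul_one]
      exact hZV
    · have h : (ℓ : ℚ_[ℓ]) ^ d * (ε * β / (W.det * δ)) * δ = 1 - δ := by
        rw [hδ, sub_sub_cancel, ← hδ]
        field_simp
        rw [hd]
        ring
      generalize ε * β / (W.det * δ) = t at *
      ext i j
      fin_cases i <;> fin_cases j <;> simp [Matrix.mul_apply, Fin.sum_univ_two]
      · linear_combination -Y 0 0 * h
      · linear_combination -Y 1 0 * h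
  · have hα1 : ‖α‖ = 1 := by
      by_contra hα1
      have h1 : ‖α * β‖ < 1 := by
        rw [norm_mul]
        exact mul_lt_one_of_nonneg_of_lt_one_left (norm_nonneg _) (lt_of_le_of_ne hα hα1) hβ
      have h2 := lt_of_le_of_ne hW.norm_det_le hw
      have h3 := IsUltrametricDist.norm_add_le_max (α * β) (-W.det)
      rw [← sub_eq_add_neg, hpf, norm_neg] at h3
      exact absurd h3 (not_le.2 (max_lt h1 h2))
    have hη : ‖-X.det / Z.det‖ = 1 := by
      have hZu : ‖Z.det‖ = ‖u‖ := by rw [hZ, norm_mul, hα1, mul_one]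
      rw [norm_mul, hZu, sq] at hXZ
      rw [norm_div, norm_neg, hZu, mul_right_cancel₀ hu' hXZ, div_self hu']
    have hη0 : -X.det / Z.det ≠ 0 := div_ne_zero (neg_ne_zero.2 hX0) hZ0
    have hXη : X.det = -(Z.det * (-X.det / Z.det)) := by
      field_simp
    have hYZ : Y = Z * (α⁻¹ • (!![0, -1; 1, 0] * W)) := by
      have h : Z.det • Y = u • (Z * (!![0, -1; 1, 0] * W)) := by
        rw [← Matrix.mul_smul, ← Matrix.mul_smul, ← hZY, det_smul_eq_mul_symplectic]
      rw [Matrix.mul_smul, ← smul_right_injective _ hZ0 |>.eq_iff]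
      simp only [h, smul_smul]
      rw [hZ, mul_assoc, mul_inv_cancel₀ hα0, mul_one]
    have hV : IsUnimodular !![(-X.det / Z.det)⁻¹, 0; 0, 1] := by
      refine isUnimodular_fin_two ?_ ?_ ?_ ?_ ?_ <;> simp [norm_inv, hη, -norm_div, -inv_div]
    have hI : IsIntegralMat (α⁻¹ • (!![0, -1; 1, 0] * W)) := by
      refine .smul (.mul (isIntegralMat_fin_two ?_ ?_ ?_ ?_) hW) ?_ <;> simp [hα1]
    generalize -X.det / Z.det = η at *
    generalize α⁻¹ • (!![0, -1; 1, 0] * W) = N at *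
    have hη1 : !![η, 0; 0, 1] * !![η⁻¹, 0; 0, 1] = 1 := by
      simp [hη0, Matrix.one_fin_two]
    refine ⟨0, Z * !![η, 0; 0, 1], !![η⁻¹, 0; 0, 1], !![η⁻¹, 0; 0, 1] * N - 1, le_rfl, hV,
      (hV.1.mul hI).sub IsUnimodular.one.1, ?_, ?_, ?_⟩
    · rw [hXη, Matrix.det_mul, Matrix.det_fin_two_of]
      ring
    · rw [zpow_zero, one_smul, Matrix.mul_assoc, hη1, Matrix.mul_one]
    · rw [zpow_zero, one_smul, Matrix.mul_sub, Matrix.mul_one, add_sub_cancel, Matrix.mul_assoc,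
        ← Matrix.mul_assoc _ _ N, hη1, Matrix.one_mul]
      exact hYZ

lemma isIntegralMat_Jmat : IsIntegralMat (Jmat ℓ) := by
  intro i j
  fin_cases i <;> fin_cases j <;> simp [Jmat]

lemma det_Jmat : (Jmat ℓ).det = 1 := by
  simp [Jmat, Matrix.det_succ_row_zero, Fin.sum_univ_succ, Fin.succAbove]
  norm_num

lemma transpose_mul_Jmat_mul_apply (g : Matrix (Fin 4) (Fin 4) ℚ_[ℓ]) (a b : Fin 4) :
    (gᵀ * Jmat ℓ * g) a b = g 0 a * g 3 b + g 1 a * g 2 b - g 2 a * g 1 b - g 3 a * g 0 b := by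
  simp [Jmat, Matrix.mul_apply, Fin.sum_univ_four]
  ring

/-- A similitude with two columns supported in rows `1`, `2` has a decomposition. -/
lemma hasDecomposition_of_gram {g Γ : Matrix (Fin 4) (Fin 4) ℚ_[ℓ]} {u : ℚ_[ℓ]} (hu : u ≠ 0)
    (hΓ : IsUnimodular Γ) (hg : gᵀ * Jmat ℓ * g = u • Γ) (h00 : g 0 0 = 0) (h01 : g 0 1 = 0)
    (h30 : g 3 0 = 0) (h31 : g 3 1 = 0) : HasDecomposition g := by
  have hgram : ∀ a b, g 0 a * g 3 b + g 1 a * g 2 b - g 2 a * g 1 b - g 3 a * g 0 b = u * Γ a b :=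
    fun a b => by rw [← transpose_mul_Jmat_mul_apply, hg, Matrix.smul_apply, smul_eq_mul]
  have hdet : ‖(!![g 0 2, g 0 3; g 3 2, g 3 3]).det * (!![g 1 0, g 1 1; g 2 0, g 2 1]).det‖ =
      ‖u‖ ^ 2 := by
    have h1 : (!![g 0 2, g 0 3; g 3 2, g 3 3]).det * (!![g 1 0, g 1 1; g 2 0, g 2 1]).det =
        g.det := by
      rw [Matrix.det_fin_two_of, Matrix.det_fin_two_of]
      simp [Matrix.det_succ_row_zero, Fin.sum_univ_succ, Fin.succAbove, h00, h01, h30, h31]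
      ring
    have h2 := congrArg (fun M => ‖Matrix.det M‖) hg
    simp only [Matrix.det_mul, Matrix.det_transpose, det_Jmat, Matrix.det_smul, norm_mul, norm_pow,
      hΓ.2, mul_one, Fintype.card_fin] at h2
    rw [h1, ← sq_eq_sq₀ (norm_nonneg _) (by positivity)]
    linear_combination h2
  have hX0 : (!![g 0 2, g 0 3; g 3 2, g 3 3]).det ≠ 0 := by
    intro h
    rw [h, zero_mul, norm_zero] at hdet
    exact pow_ne_zero 2 (norm_ne_zero_iff.2 hu) hdet.symm
  obtain ⟨d, Y', V, T, hd, hV, hT, hXY', hZ, hY⟩ := exists_gluing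
    (Y := !![g 1 2, g 1 3; g 2 2, g 2 3]) (W := !![Γ 0 2, Γ 0 3; Γ 1 2, Γ 1 3])
    (hΓ.1 0 1) (hΓ.1 2 3)
    (isIntegralMat_fin_two (hΓ.1 _ _) (hΓ.1 _ _) (hΓ.1 _ _) (hΓ.1 _ _)) hu
    (by
      rw [← hgram, Matrix.det_fin_two_of, h00, h30]
      ring)
    (by
      ext i j
      fin_cases i <;> fin_cases j <;>
        simp [← hgram, Matrix.mul_apply, Fin.sum_univ_two, h00, h01, h30, h31] <;>
        ring)
    (by
      rw [← hgram, Matrix.det_fin_two_of, Matrix.det_fin_two_of]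
      ring) hdet
  have hg' : g = gluedMat d !![g 0 2, g 0 3; g 3 2, g 3 3] Y' * blockUpper V T 1 := by
    have e1 := fun i j => congrFun (congrFun hZ i) j
    have e2 := fun i j => congrFun (congrFun hY i) j
    simp [Fin.forall_fin_two, Matrix.mul_apply, Fin.sum_univ_two] at e1 e2
    ext i j
    fin_cases i <;> fin_cases j <;>
      simp [gluedMat, blockUpper, Matrix.mul_apply, Fin.sum_univ_four, h00, h01, h30, h31, e1, e2] <;>
      ring
  rw [hg']
  exact (hasDecomposition_gluedMat hd hX0 hXY').mul_right (hV.blockUpper hT .one)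

lemma hasDecomposition_of_similitude {g : Matrix (Fin 4) (Fin 4) ℚ_[ℓ]} {u : ℚ_[ℓ]} (hu : u ≠ 0)
    (hg : gᵀ * Jmat ℓ * g = u • Jmat ℓ) : HasDecomposition g := by
  obtain ⟨k, hk, hk0, -⟩ := exists_pivot (Finset.mem_univ (3 : Fin 4)) (g 0)
  obtain ⟨m, hm, hm0, hm1⟩ := exists_pivot (s := {0, 1, 2}) (j := (2 : Fin 4)) (by simp)
    ((g * k) 3)
  refine .of_mul_right (hk.mul hm) ?_
  have h0 : (g * (k * m)) 0 = (g * k) 0 := by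
    rw [← Matrix.mul_assoc, Matrix.mul_apply_eq_vecMul (g * k)]
    refine hm1 _ fun i hi => ?_
    rw [Matrix.mul_apply_eq_vecMul]
    refine hk0 i (Finset.mem_univ _) ?_
    rintro rfl
    simp at hi
  have h3 : (g * (k * m)) 3 = (g * k) 3 ᵥ* m := by
    rw [← Matrix.mul_assoc, Matrix.mul_apply_eq_vecMul (g * k)]
  refine hasDecomposition_of_gram (Γ := (k * m)ᵀ * Jmat ℓ * (k * m)) hu
    (((hk.mul hm).transpose.mul ⟨isIntegralMat_Jmat, by simp [det_Jmat]⟩).mul (hk.mul hm))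
    ?_ ?_ ?_ ?_ ?_
  · rw [Matrix.transpose_mul, ← Matrix.smul_mul, ← Matrix.mul_smul, ← hg]
    simp only [Matrix.mul_assoc]
  · rw [h0, Matrix.mul_apply_eq_vecMul]
    exact hk0 0 (Finset.mem_univ _) (by decide)
  · rw [h0, Matrix.mul_apply_eq_vecMul]
    exact hk0 1 (Finset.mem_univ _) (by decide)
  · rw [h3]
    exact hm0 0 (by simp) (by decide)
  · rw [h3]
    exact hm0 1 (by simp) (by decide)

lemma iotaMat_similitude {h₁ h₂ : Matrix (Fin 2) (Fin 2) ℚ_[ℓ]} (h : h₁.det = h₂.det) :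
    (iotaMat ℓ h₁ h₂)ᵀ * Jmat ℓ * iotaMat ℓ h₁ h₂ = h₁.det • Jmat ℓ := by
  have h' := h
  rw [Matrix.det_fin_two h₁, Matrix.det_fin_two h₂] at h'
  ext a b
  rw [transpose_mul_Jmat_mul_apply, Matrix.det_fin_two]
  fin_cases a <;> fin_cases b <;> simp [iotaMat, Jmat] <;>
    first
    | ring1
    | linear_combination h'
    | linear_combination -h'

lemma tMat_similitude (ν : Fin 3 → ℤ) :
    (tMat ℓ ν)ᵀ * Jmat ℓ * tMat ℓ ν = (ℓ : ℚ_[ℓ]) ^ ν 2 • Jmat ℓ := by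
  have hp := cast_ne_zero_padic (ℓ := ℓ)
  ext a b
  rw [transpose_mul_Jmat_mul_apply]
  fin_cases a <;> fin_cases b <;>
    simp [tMat, Jmat, ← zpow_add₀ hp]

lemma Bmat_similitude : (Bmat ℓ)ᵀ * Jmat ℓ * Bmat ℓ = Jmat ℓ := by
  ext a b
  rw [transpose_mul_Jmat_mul_apply]
  fin_cases a <;> fin_cases b <;> simp [Bmat, Jmat]

lemma similitude_mul {M N : Matrix (Fin 4) (Fin 4) ℚ_[ℓ]} {a b : ℚ_[ℓ]}
    (hM : Mᵀ * Jmat ℓ * M = a • Jmat ℓ) (hN : Nᵀ * Jmat ℓ * N = b • Jmat ℓ) :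
    (M * N)ᵀ * Jmat ℓ * (M * N) = (a * b) • Jmat ℓ := by
  calc (M * N)ᵀ * Jmat ℓ * (M * N) = Nᵀ * (Mᵀ * Jmat ℓ * M) * N := by
        rw [Matrix.transpose_mul]
        simp only [Matrix.mul_assoc]
    _ = (a * b) • Jmat ℓ := by
        rw [hM, Matrix.mul_smul, Matrix.smul_mul, hN, smul_smul]

lemma exists_similitude_of_mul {M N : Matrix (Fin 4) (Fin 4) ℚ_[ℓ]} {a b : ℚ_[ℓ]} (ha : a ≠ 0)
    (hM : Mᵀ * Jmat ℓ * M = a • Jmat ℓ) (hMN : (M * N)ᵀ * Jmat ℓ * (M * N) = b • Jmat ℓ) :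
    Nᵀ * Jmat ℓ * N = (a⁻¹ * b) • Jmat ℓ := by
  have h : a • (Nᵀ * Jmat ℓ * N) = b • Jmat ℓ := by
    rw [← hMN, Matrix.transpose_mul, ← Matrix.smul_mul, ← Matrix.mul_smul, ← hM]
    simp only [Matrix.mul_assoc]
  rw [mul_smul, ← h, smul_smul, inv_mul_cancel₀ ha, one_smul]

end Lemmas

/-- Existence part of Gejima's Cartan-type decomposition: every `g ∈ GSp₄(ℚ_ℓ)`
can be written as `ι(h) · 𝐠(μ',μ) · k` with `(μ',μ) ∈ Λ₀⁺⁺ × Λ⁺`,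
`h ∈ H(ℤ_ℓ)` and `k ∈ GSp₄(ℤ_ℓ)`. -/
theorem cartan_decomposition_existence (g : GL (Fin 4) ℚ_[ℓ]) (hg : IsGSp4 ℓ g) :
    ∃ μ' μ : Fin 3 → ℤ, InLambdaZeroPlusPlus μ' ∧ InLambdaPlus μ ∧
      ∃ h₁ h₂ : GL (Fin 2) ℚ_[ℓ],
        (h₁ : Matrix (Fin 2) (Fin 2) ℚ_[ℓ]).det = (h₂ : Matrix (Fin 2) (Fin 2) ℚ_[ℓ]).det ∧
        IsIntegralGL ℓ h₁ ∧ IsIntegralGL ℓ h₂ ∧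
        ∃ k : GL (Fin 4) ℚ_[ℓ], IsGSp4 ℓ k ∧ IsIntegralGL ℓ k ∧
          (g : Matrix (Fin 4) (Fin 4) ℚ_[ℓ]) =
            iotaMat ℓ (h₁ : Matrix (Fin 2) (Fin 2) ℚ_[ℓ])
                (h₂ : Matrix (Fin 2) (Fin 2) ℚ_[ℓ]) *
              gRep ℓ μ' μ * (k : Matrix (Fin 4) (Fin 4) ℚ_[ℓ]) := by
  obtain ⟨u, hu⟩ := hg
  obtain ⟨μ', μ, hμ', hμ, h₁, h₂, hdet, hh₁, hh₂, k, hk, hgk⟩ :=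
    hasDecomposition_of_similitude u.ne_zero hu
  have hM : (iotaMat ℓ h₁ h₂ * gRep ℓ μ' μ)ᵀ * Jmat ℓ * (iotaMat ℓ h₁ h₂ * gRep ℓ μ' μ) =
      (h₁.det * ((ℓ : ℚ_[ℓ]) ^ μ' 2 * 1 * (ℓ : ℚ_[ℓ]) ^ μ 2)) • Jmat ℓ :=
    similitude_mul (iotaMat_similitude hdet) (similitude_mul
      (similitude_mul (tMat_similitude μ') (by rw [Bmat_similitude, one_smul])) (tMat_similitude μ))
  have ha : h₁.det * ((ℓ : ℚ_[ℓ]) ^ μ' 2 * 1 * (ℓ : ℚ_[ℓ]) ^ μ 2) ≠ 0 :=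
    mul_ne_zero hh₁.det_ne_zero (by simp [zpow_ne_zero_padic])
  have hkJ := exists_similitude_of_mul ha hM (hgk ▸ hu)
  obtain ⟨g₁, rfl, hg₁⟩ := hh₁.exists_isIntegralGL
  obtain ⟨g₂, rfl, hg₂⟩ := hh₂.exists_isIntegralGL
  obtain ⟨k, rfl, hk'⟩ := hk.exists_isIntegralGL
  exact ⟨μ', μ, hμ', hμ, g₁, g₂, hdet, hg₁, hg₂, k,
    ⟨Units.mk0 _ (mul_ne_zero (inv_ne_zero ha) u.ne_zero), hkJ⟩, hk', hgk⟩

end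
end

section
/- Let (h₁,h₂) ∈ GL₂(ℤ_ℓ) × GL₂(ℤ_ℓ) with h₁ ∈ K₁(ℓ²), h₂ ∈ K¹(ℓ²) and det h₁ = det h₂. Then: (i) φ_{ℓ,2}((x,y)·h₁) = φ_{ℓ,2}((x,y)) for all row vectors (x,y) ∈ ℚ_ℓ²; (ii) η_ℓ⁻¹·ι(h₁,h₂)·η_ℓ ∈ GSp₄(ℤ_ℓ); (iii) m⁻¹·h₂·m ∈ K₁(ℓ) for each of the two matrices m = (0,−1;ℓ²,0) and m = (0,−ℓ;ℓ²,0). -/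
/- STATEMENT 6: properties of elements of K₁(ℓ²) ×_{det} K¹(ℓ²). -/

/- STATEMENT 0: Existence part of the Cartan-type decomposition
   GSp₄(ℚ_ℓ) = ⊔ H(ℤ_ℓ) 𝐠(μ',μ) GSp₄(ℤ_ℓ). -/

open Matrix

noncomputable section

variable (ℓ : ℕ) [Fact ℓ.Prime]

/-- The characteristic function `φ_{ℓ,2}` of `ℓ²ℤ_ℓ × (1 + ℓ²ℤ_ℓ)` on row vectors. -/
def phiL2 : (Fin 2 → ℚ_[ℓ]) → ℂ :=
  Set.indicator {v : Fin 2 → ℚ_[ℓ] | ‖v 0‖ ≤ ((ℓ : ℝ) ^ 2)⁻¹ ∧ ‖v 1 - 1‖ ≤ ((ℓ : ℝ) ^ 2)⁻¹}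
    fun _ => 1

/-- The matrix `η_ℓ`. -/
def etaMat : Matrix (Fin 4) (Fin 4) ℚ_[ℓ] :=
  !![1, 0, (ℓ : ℚ_[ℓ])⁻¹, 0;
     0, 1, 0, (ℓ : ℚ_[ℓ])⁻¹;
     0, 0, 1, 0;
     0, 0, 0, 1]

/-- A linear combination, with integral coefficients, of elements of norm at most `r`
has norm at most `r`. -/
theorem norm_mul_add_mul_le {r : ℝ} {x y u v : ℚ_[ℓ]} (hx : ‖x‖ ≤ r) (hy : ‖y‖ ≤ r)
    (hu : ‖u‖ ≤ 1) (hv : ‖v‖ ≤ 1) : ‖x * u + y * v‖ ≤ r := by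
  refine (Padic.nonarchimedean _ _).trans (max_le ?_ ?_)
  · rw [norm_mul]
    exact (mul_le_of_le_one_right (norm_nonneg _) hu).trans hx
  · rw [norm_mul]
    exact (mul_le_of_le_one_right (norm_nonneg _) hv).trans hy

variable {ℓ} in
theorem IsIntegralGL.inv {n : ℕ} {g : GL (Fin n) ℚ_[ℓ]} (hg : IsIntegralGL ℓ g) :
    IsIntegralGL ℓ g⁻¹ :=
  ⟨hg.2, by simpa using hg.1⟩

/-- The bottom row of `h` being congruent to `(0, 1)` is stable under inversion. -/
theorem inv_bottom_row {r : ℝ} {h : GL (Fin 2) ℚ_[ℓ]} (hint : IsIntegralGL ℓ h)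
    (hc : ‖h.1 1 0‖ ≤ r) (hd : ‖h.1 1 1 - 1‖ ≤ r) :
    ‖(h⁻¹).1 1 0‖ ≤ r ∧ ‖(h⁻¹).1 1 1 - 1‖ ≤ r := by
  have hmul : h.1 * (h⁻¹).1 = 1 := h.mul_inv
  have h10 := congrFun₂ hmul 1 0
  have h11 := congrFun₂ hmul 1 1
  simp only [Matrix.mul_apply, Fin.sum_univ_two, Matrix.one_apply_eq] at h10 h11
  rw [Matrix.one_apply_ne (by decide)] at h10
  rw [← norm_neg] at hc hd
  refine ⟨?_, ?_⟩
  · convert norm_mul_add_mul_le ℓ hd hc (hint.2 1 0) (hint.2 0 0) using 2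
    linear_combination h10
  · convert norm_mul_add_mul_le ℓ hd hc (hint.2 1 1) (hint.2 0 1) using 2
    linear_combination h11

/-- The left column of `h` being congruent to `(1, 0)` is stable under inversion. -/
theorem inv_left_column {r : ℝ} {h : GL (Fin 2) ℚ_[ℓ]} (hint : IsIntegralGL ℓ h)
    (hc : ‖h.1 1 0‖ ≤ r) (ha : ‖h.1 0 0 - 1‖ ≤ r) :
    ‖(h⁻¹).1 1 0‖ ≤ r ∧ ‖(h⁻¹).1 0 0 - 1‖ ≤ r := by
  have hmul : (h⁻¹).1 * h.1 = 1 := h.inv_mul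
  have h10 := congrFun₂ hmul 1 0
  have h00 := congrFun₂ hmul 0 0
  simp only [Matrix.mul_apply, Fin.sum_univ_two, Matrix.one_apply_eq] at h10 h00
  rw [Matrix.one_apply_ne (by decide)] at h10
  rw [← norm_neg] at hc ha
  refine ⟨?_, ?_⟩
  · convert norm_mul_add_mul_le ℓ ha hc (hint.2 1 0) (hint.2 1 1) using 2
    linear_combination h10
  · convert norm_mul_add_mul_le ℓ ha hc (hint.2 0 0) (hint.2 0 1) using 2
    linear_combination h00

/-- Elements of `K₁(ℓ²)` preserve the support of `φ_{ℓ,2}`. -/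
theorem vecMul_mem_support {r : ℝ} (hr : r ≤ 1) {h : GL (Fin 2) ℚ_[ℓ]}
    (hint : IsIntegralGL ℓ h) (hc : ‖h.1 1 0‖ ≤ r) (hd : ‖h.1 1 1 - 1‖ ≤ r)
    {v : Fin 2 → ℚ_[ℓ]} (hv : ‖v 0‖ ≤ r ∧ ‖v 1 - 1‖ ≤ r) :
    ‖Matrix.vecMul v h.1 0‖ ≤ r ∧ ‖Matrix.vecMul v h.1 1 - 1‖ ≤ r := by
  have hv1 : ‖v 1‖ ≤ 1 := by
    simpa using (Padic.nonarchimedean (v 1 - 1) 1).trans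
      (max_le (hv.2.trans hr) norm_one.le)
  simp only [Matrix.vecMul, dotProduct, Fin.sum_univ_two]
  refine ⟨?_, ?_⟩
  · rw [mul_comm (v 1)]
    exact norm_mul_add_mul_le ℓ hv.1 hc (hint.1 0 0) hv1
  · have h1 := norm_mul_add_mul_le ℓ hv.1 hd (hint.1 0 1) hv1
    convert norm_mul_add_mul_le ℓ h1 hv.2 norm_one.le norm_one.le using 2
    ring

/-- The inverse of `η_ℓ`. -/
def etaInvMat : Matrix (Fin 4) (Fin 4) ℚ_[ℓ] :=
  !![1, 0, -(ℓ : ℚ_[ℓ])⁻¹, 0;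
     0, 1, 0, -(ℓ : ℚ_[ℓ])⁻¹;
     0, 0, 1, 0;
     0, 0, 0, 1]

theorem etaMat_mul_etaInvMat : etaMat ℓ * etaInvMat ℓ = 1 := by
  ext i j
  fin_cases i <;> fin_cases j <;>
    simp [etaMat, etaInvMat, Matrix.mul_apply, Fin.sum_univ_four]

/-- `η_ℓ` as an element of `GL₄(ℚ_ℓ)`. -/
def etaGL : GL (Fin 4) ℚ_[ℓ] :=
  ⟨etaMat ℓ, etaInvMat ℓ, etaMat_mul_etaInvMat ℓ,
    mul_eq_one_comm.mp (etaMat_mul_etaInvMat ℓ)⟩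

theorem iotaMat_mul (a b c d : Matrix (Fin 2) (Fin 2) ℚ_[ℓ]) :
    iotaMat ℓ a b * iotaMat ℓ c d = iotaMat ℓ (a * c) (b * d) := by
  ext i j
  fin_cases i <;> fin_cases j <;>
    simp [iotaMat, Matrix.mul_apply, Fin.sum_univ_four]

theorem iotaMat_one : iotaMat ℓ 1 1 = 1 := by
  ext i j
  fin_cases i <;> fin_cases j <;> simp [iotaMat]

/-- `ι` with values in `GL₄(ℚ_ℓ)`. -/
def iotaGL (h₁ h₂ : GL (Fin 2) ℚ_[ℓ]) : GL (Fin 4) ℚ_[ℓ] where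
  val := iotaMat ℓ h₁.1 h₂.1
  inv := iotaMat ℓ (h₁⁻¹).1 (h₂⁻¹).1
  val_inv := by rw [iotaMat_mul, Units.mul_inv, Units.mul_inv, iotaMat_one]
  inv_val := by rw [iotaMat_mul, Units.inv_mul, Units.inv_mul, iotaMat_one]

theorem isGSp4_etaGL : IsGSp4 ℓ (etaGL ℓ) := by
  refine ⟨1, ?_⟩
  ext i j
  fin_cases i <;> fin_cases j <;>
    simp [etaGL, etaMat, Jmat, Matrix.mul_apply, Fin.sum_univ_four]

theorem isGSp4_iotaGL {h₁ h₂ : GL (Fin 2) ℚ_[ℓ]} (hdet : h₁.1.det = h₂.1.det) :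
    IsGSp4 ℓ (iotaGL ℓ h₁ h₂) := by
  refine ⟨Matrix.GeneralLinearGroup.det h₁, ?_⟩
  rw [Matrix.det_fin_two, Matrix.det_fin_two] at hdet
  ext i j
  fin_cases i <;> fin_cases j <;>
    simp [iotaGL, iotaMat, Jmat, Matrix.mul_apply, Fin.sum_univ_four, Matrix.det_fin_two] <;>
    grind

variable {ℓ} in
theorem IsGSp4.mul {g h : GL (Fin 4) ℚ_[ℓ]} (hg : IsGSp4 ℓ g) (hh : IsGSp4 ℓ h) :
    IsGSp4 ℓ (g * h) := by
  obtain ⟨u, hu⟩ := hg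
  obtain ⟨w, hw⟩ := hh
  refine ⟨u * w, ?_⟩
  calc (g * h).1ᵀ * Jmat ℓ * (g * h).1 = h.1ᵀ * (g.1ᵀ * Jmat ℓ * g.1) * h.1 := by
        simp only [Units.val_mul, Matrix.transpose_mul, Matrix.mul_assoc]
    _ = _ := by
        rw [hu, Matrix.mul_smul, Matrix.smul_mul, hw, smul_smul, Units.val_mul]

variable {ℓ} in
theorem IsGSp4.inv {g : GL (Fin 4) ℚ_[ℓ]} (hg : IsGSp4 ℓ g) : IsGSp4 ℓ g⁻¹ := by
  obtain ⟨u, hu⟩ := hg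
  refine ⟨u⁻¹, ?_⟩
  have hmul : g.1 * (g⁻¹).1 = 1 := g.mul_inv
  have hT : (g⁻¹).1ᵀ * g.1ᵀ = 1 := by rw [← Matrix.transpose_mul, hmul, Matrix.transpose_one]
  have hJ : (u : ℚ_[ℓ]) • ((g⁻¹).1ᵀ * Jmat ℓ * (g⁻¹).1) = Jmat ℓ := by
    rw [← Matrix.smul_mul, ← Matrix.mul_smul, ← hu]
    calc _ = ((g⁻¹).1ᵀ * g.1ᵀ) * Jmat ℓ * (g.1 * (g⁻¹).1) := by
          simp only [Matrix.mul_assoc]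
      _ = _ := by rw [hT, hmul, Matrix.one_mul, Matrix.mul_one]
  conv_rhs => rw [← hJ]
  rw [smul_smul, Units.inv_mul, one_smul]

theorem exists_eq_pow_mul (n : ℕ) {x : ℚ_[ℓ]} (hx : ‖x‖ ≤ ((ℓ : ℝ) ^ n)⁻¹) :
    ∃ y : ℤ_[ℓ], x = (ℓ : ℚ_[ℓ]) ^ n * y := by
  have hℓ : (ℓ : ℚ_[ℓ]) ≠ 0 := Nat.cast_ne_zero.mpr (Fact.out : ℓ.Prime).ne_zero
  have hℓ0 : (0 : ℝ) < ℓ := Nat.cast_pos.mpr (Fact.out : ℓ.Prime).pos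
  refine ⟨⟨((ℓ : ℚ_[ℓ]) ^ n)⁻¹ * x, ?_⟩, ?_⟩
  · rw [norm_mul, norm_inv, norm_pow, Padic.norm_p, inv_pow, inv_inv]
    calc _ ≤ (ℓ : ℝ) ^ n * ((ℓ : ℝ) ^ n)⁻¹ := by gcongr
      _ = 1 := mul_inv_cancel₀ (by positivity)
  · exact (mul_inv_cancel_left₀ (pow_ne_zero n hℓ) x).symm

theorem norm_conj_iotaGL_le_one {h₁ h₂ : GL (Fin 2) ℚ_[ℓ]}
    (h₁int : IsIntegralGL ℓ h₁) (h₂int : IsIntegralGL ℓ h₂)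
    (hc₁ : ‖h₁.1 1 0‖ ≤ ((ℓ : ℝ) ^ 2)⁻¹) (hd₁ : ‖h₁.1 1 1 - 1‖ ≤ ((ℓ : ℝ) ^ 2)⁻¹)
    (hc₂ : ‖h₂.1 1 0‖ ≤ ((ℓ : ℝ) ^ 2)⁻¹) (ha₂ : ‖h₂.1 0 0 - 1‖ ≤ ((ℓ : ℝ) ^ 2)⁻¹)
    (hdet : h₁.1.det = h₂.1.det) (i j : Fin 4) :
    ‖((etaGL ℓ)⁻¹ * iotaGL ℓ h₁ h₂ * etaGL ℓ).1 i j‖ ≤ 1 := by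
  have hℓ : (ℓ : ℚ_[ℓ]) ≠ 0 := Nat.cast_ne_zero.mpr (Fact.out : ℓ.Prime).ne_zero
  obtain ⟨c₁, hc₁⟩ := exists_eq_pow_mul ℓ 2 hc₁
  obtain ⟨c₂, hc₂⟩ := exists_eq_pow_mul ℓ 2 hc₂
  obtain ⟨d₁, hd₁⟩ := exists_eq_pow_mul ℓ 2 hd₁
  obtain ⟨a₂, ha₂⟩ := exists_eq_pow_mul ℓ 2 ha₂
  obtain ⟨a₁, ha₁⟩ : ∃ y : ℤ_[ℓ], h₁.1 0 0 = y := ⟨⟨_, h₁int.1 0 0⟩, rfl⟩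
  obtain ⟨b₁, hb₁⟩ : ∃ y : ℤ_[ℓ], h₁.1 0 1 = y := ⟨⟨_, h₁int.1 0 1⟩, rfl⟩
  obtain ⟨b₂, hb₂⟩ : ∃ y : ℤ_[ℓ], h₂.1 0 1 = y := ⟨⟨_, h₂int.1 0 1⟩, rfl⟩
  obtain ⟨d₂, hd₂⟩ : ∃ y : ℤ_[ℓ], h₂.1 1 1 = y := ⟨⟨_, h₂int.1 1 1⟩, rfl⟩
  rw [sub_eq_iff_eq_add] at hd₁ ha₂
  rw [Matrix.det_fin_two, Matrix.det_fin_two, ha₁, hb₁, hc₁, hd₁, ha₂, hb₂, hc₂, hd₂] at hdet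
  have ha₁' : (a₁ : ℚ_[ℓ]) =
      d₂ + (ℓ : ℚ_[ℓ]) ^ 2 * (a₂ * d₂ - b₂ * c₂ - a₁ * d₁ + b₁ * c₁) := by
    linear_combination hdet
  have key : ((etaGL ℓ)⁻¹ * iotaGL ℓ h₁ h₂ * etaGL ℓ).1 =
      (!![a₁, -(ℓ * c₂), ℓ * (a₂ * d₂ - b₂ * c₂ - a₁ * d₁ + b₁ * c₁), b₁ - c₂;
         -(ℓ * c₁), 1 + ℓ ^ 2 * a₂, b₂ - c₁, ℓ * (a₂ - d₁);
         0, ℓ ^ 2 * c₂, d₂, ℓ * c₂;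
         ℓ ^ 2 * c₁, 0, ℓ * c₁, 1 + ℓ ^ 2 * d₁] : Matrix (Fin 4) (Fin 4) ℤ_[ℓ]).map (algebraMap ℤ_[ℓ] ℚ_[ℓ]) := by
    change etaInvMat ℓ * iotaMat ℓ h₁.1 h₂.1 * etaMat ℓ = _
    ext i j
    fin_cases i <;> fin_cases j <;>
      simp [etaInvMat, iotaMat, etaMat, Matrix.mul_apply, Fin.sum_univ_four,
        ha₁, hb₁, hc₁, hd₁, ha₂, hb₂, hc₂, hd₂] <;>
      grind
  rw [key]
  exact PadicInt.norm_le_one _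

theorem isIntegralGL_conj_iotaGL {h₁ h₂ : GL (Fin 2) ℚ_[ℓ]}
    (h₁int : IsIntegralGL ℓ h₁) (h₂int : IsIntegralGL ℓ h₂)
    (hc₁ : ‖h₁.1 1 0‖ ≤ ((ℓ : ℝ) ^ 2)⁻¹) (hd₁ : ‖h₁.1 1 1 - 1‖ ≤ ((ℓ : ℝ) ^ 2)⁻¹)
    (hc₂ : ‖h₂.1 1 0‖ ≤ ((ℓ : ℝ) ^ 2)⁻¹) (ha₂ : ‖h₂.1 0 0 - 1‖ ≤ ((ℓ : ℝ) ^ 2)⁻¹)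
    (hdet : h₁.1.det = h₂.1.det) :
    IsIntegralGL ℓ ((etaGL ℓ)⁻¹ * iotaGL ℓ h₁ h₂ * etaGL ℓ) := by
  refine ⟨norm_conj_iotaGL_le_one ℓ h₁int h₂int hc₁ hd₁ hc₂ ha₂ hdet, ?_⟩
  have hinv : ((etaGL ℓ)⁻¹ * iotaGL ℓ h₁ h₂ * etaGL ℓ)⁻¹ =
      (etaGL ℓ)⁻¹ * iotaGL ℓ h₁⁻¹ h₂⁻¹ * etaGL ℓ := by
    have : iotaGL ℓ h₁⁻¹ h₂⁻¹ = (iotaGL ℓ h₁ h₂)⁻¹ := Units.ext rfl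
    rw [this]
    group
  have hdet' : (h₁⁻¹).1.det = (h₂⁻¹).1.det := by
    have h : Matrix.GeneralLinearGroup.det h₁ = Matrix.GeneralLinearGroup.det h₂ :=
      Units.ext hdet
    have := congrArg (fun u => u⁻¹) h
    rw [← map_inv, ← map_inv] at this
    exact congrArg Units.val this
  obtain ⟨hc₁', hd₁'⟩ := inv_bottom_row ℓ h₁int hc₁ hd₁
  obtain ⟨hc₂', ha₂'⟩ := inv_left_column ℓ h₂int hc₂ ha₂
  rw [hinv]
  exact norm_conj_iotaGL_le_one ℓ h₁int.inv h₂int.inv hc₁' hd₁' hc₂' ha₂' hdet'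

/-- The matrix `(0, -x; ℓ², 0)` as an element of `GL₂(ℚ_ℓ)`. -/
def antidiagGL (x : (ℚ_[ℓ])ˣ) : GL (Fin 2) ℚ_[ℓ] :=
  Matrix.GeneralLinearGroup.mkOfDetNeZero !![0, -(x : ℚ_[ℓ]); (ℓ : ℚ_[ℓ]) ^ 2, 0] <| by
    simp [Matrix.det_fin_two, (Fact.out : ℓ.Prime).ne_zero]

theorem conj_antidiagGL (x : (ℚ_[ℓ])ˣ) (h : GL (Fin 2) ℚ_[ℓ]) :
    ((antidiagGL ℓ x)⁻¹ * h * antidiagGL ℓ x).1 =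
      !![h.1 1 1, -(x * h.1 1 0 / (ℓ : ℚ_[ℓ]) ^ 2);
         -((ℓ : ℚ_[ℓ]) ^ 2 / x * h.1 0 1), h.1 0 0] := by
  have hℓ : (ℓ : ℚ_[ℓ]) ≠ 0 := Nat.cast_ne_zero.mpr (Fact.out : ℓ.Prime).ne_zero
  have hx : (x : ℚ_[ℓ]) ≠ 0 := x.ne_zero
  rw [mul_assoc, Units.val_mul, Units.inv_mul_eq_iff_eq_mul]
  change h.1 * !![0, -(x : ℚ_[ℓ]); (ℓ : ℚ_[ℓ]) ^ 2, 0] =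
    !![0, -(x : ℚ_[ℓ]); (ℓ : ℚ_[ℓ]) ^ 2, 0] * _
  ext i j
  fin_cases i <;> fin_cases j <;> simp [Matrix.mul_apply, Fin.sum_univ_two] <;> field_simp

theorem norm_conj_antidiagGL_le_one {x : (ℚ_[ℓ])ˣ} (hx : ‖(x : ℚ_[ℓ])‖ ≤ 1)
    (hx' : ‖(ℓ : ℚ_[ℓ]) ^ 2 / x‖ ≤ 1) {h : GL (Fin 2) ℚ_[ℓ]} (hint : IsIntegralGL ℓ h)
    (hc : ‖h.1 1 0‖ ≤ ((ℓ : ℝ) ^ 2)⁻¹) (i j : Fin 2) :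
    ‖((antidiagGL ℓ x)⁻¹ * h * antidiagGL ℓ x).1 i j‖ ≤ 1 := by
  have hℓ : (ℓ : ℚ_[ℓ]) ≠ 0 := Nat.cast_ne_zero.mpr (Fact.out : ℓ.Prime).ne_zero
  rw [conj_antidiagGL]
  fin_cases i <;> fin_cases j
  · exact hint.1 1 1
  · obtain ⟨c, hc⟩ := exists_eq_pow_mul ℓ 2 hc
    change ‖-((x : ℚ_[ℓ]) * h.1 1 0 / (ℓ : ℚ_[ℓ]) ^ 2)‖ ≤ 1
    rw [hc, mul_div_assoc, mul_div_cancel_left₀ _ (pow_ne_zero 2 hℓ), norm_neg, norm_mul]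
    exact mul_le_one₀ hx (norm_nonneg _) c.norm_le_one
  · change ‖-((ℓ : ℚ_[ℓ]) ^ 2 / x * h.1 0 1)‖ ≤ 1
    rw [norm_neg, norm_mul]
    exact mul_le_one₀ hx' (norm_nonneg _) (hint.1 0 1)
  · exact hint.1 0 0

theorem conj_antidiagGL_properties {x : (ℚ_[ℓ])ˣ} (hx : ‖(x : ℚ_[ℓ])‖ ≤ 1)
    (hx' : ‖(ℓ : ℚ_[ℓ]) ^ 2 / x‖ ≤ (ℓ : ℝ)⁻¹) {h : GL (Fin 2) ℚ_[ℓ]}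
    (hint : IsIntegralGL ℓ h) (hc : ‖h.1 1 0‖ ≤ ((ℓ : ℝ) ^ 2)⁻¹)
    (ha : ‖h.1 0 0 - 1‖ ≤ ((ℓ : ℝ) ^ 2)⁻¹) :
    ∃ k : GL (Fin 2) ℚ_[ℓ], IsIntegralGL ℓ k ∧ ‖k.1 1 0‖ ≤ (ℓ : ℝ)⁻¹ ∧
      ‖k.1 1 1 - 1‖ ≤ (ℓ : ℝ)⁻¹ ∧
      k.1 = !![0, -(x : ℚ_[ℓ]); (ℓ : ℚ_[ℓ]) ^ 2, 0]⁻¹ * h.1 *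
        !![0, -(x : ℚ_[ℓ]); (ℓ : ℚ_[ℓ]) ^ 2, 0] := by
  have hℓ : (1 : ℝ) ≤ ℓ := Nat.one_le_cast.mpr (Fact.out : ℓ.Prime).one_le
  have hx1 : ‖(ℓ : ℚ_[ℓ]) ^ 2 / x‖ ≤ 1 := hx'.trans (inv_le_one_of_one_le₀ hℓ)
  have hinv : ((antidiagGL ℓ x)⁻¹ * h * antidiagGL ℓ x)⁻¹ =
      (antidiagGL ℓ x)⁻¹ * h⁻¹ * antidiagGL ℓ x := by group
  refine ⟨(antidiagGL ℓ x)⁻¹ * h * antidiagGL ℓ x,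
    ⟨norm_conj_antidiagGL_le_one ℓ hx hx1 hint hc, ?_⟩, ?_, ?_, ?_⟩
  · rw [hinv]
    exact norm_conj_antidiagGL_le_one ℓ hx hx1 hint.inv (inv_left_column ℓ hint hc ha).1
  · rw [conj_antidiagGL]
    change ‖-((ℓ : ℚ_[ℓ]) ^ 2 / x * h.1 0 1)‖ ≤ _
    rw [norm_neg, norm_mul]
    exact (mul_le_of_le_one_right (norm_nonneg _) (hint.1 0 1)).trans hx'
  · rw [conj_antidiagGL]
    refine ha.trans (inv_anti₀ (by positivity) ?_)
    nlinarith
  · rw [Units.val_mul, Units.val_mul, Matrix.coe_units_inv]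
    rfl

theorem level_properties (h₁ h₂ : GL (Fin 2) ℚ_[ℓ])
    (h₁int : IsIntegralGL ℓ h₁) (h₂int : IsIntegralGL ℓ h₂)
    (h₁K : ‖(h₁ : Matrix (Fin 2) (Fin 2) ℚ_[ℓ]) 1 0‖ ≤ ((ℓ : ℝ) ^ 2)⁻¹ ∧
           ‖(h₁ : Matrix (Fin 2) (Fin 2) ℚ_[ℓ]) 1 1 - 1‖ ≤ ((ℓ : ℝ) ^ 2)⁻¹)
    (h₂K : ‖(h₂ : Matrix (Fin 2) (Fin 2) ℚ_[ℓ]) 1 0‖ ≤ ((ℓ : ℝ) ^ 2)⁻¹ ∧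
           ‖(h₂ : Matrix (Fin 2) (Fin 2) ℚ_[ℓ]) 0 0 - 1‖ ≤ ((ℓ : ℝ) ^ 2)⁻¹)
    (hdet : (h₁ : Matrix (Fin 2) (Fin 2) ℚ_[ℓ]).det = (h₂ : Matrix (Fin 2) (Fin 2) ℚ_[ℓ]).det) :
    -- (i) φ_{ℓ,2} is invariant under right translation of the row vector by h₁
    (∀ v : Fin 2 → ℚ_[ℓ],
        phiL2 ℓ (Matrix.vecMul v (h₁ : Matrix (Fin 2) (Fin 2) ℚ_[ℓ])) = phiL2 ℓ v) ∧
    -- (ii) η_ℓ⁻¹ · ι(h₁,h₂) · η_ℓ ∈ GSp₄(ℤ_ℓ)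
    (∃ k : GL (Fin 4) ℚ_[ℓ], IsGSp4 ℓ k ∧ IsIntegralGL ℓ k ∧
        (k : Matrix (Fin 4) (Fin 4) ℚ_[ℓ]) =
          (etaMat ℓ)⁻¹ *
            iotaMat ℓ (h₁ : Matrix (Fin 2) (Fin 2) ℚ_[ℓ])
              (h₂ : Matrix (Fin 2) (Fin 2) ℚ_[ℓ]) * etaMat ℓ) ∧
    -- (iii) m⁻¹ · h₂ · m ∈ K₁(ℓ) for the two matrices m
    (∀ m ∈ ({!![0, -1; (ℓ : ℚ_[ℓ]) ^ 2, 0], !![0, -(ℓ : ℚ_[ℓ]); (ℓ : ℚ_[ℓ]) ^ 2, 0]} :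
        Set (Matrix (Fin 2) (Fin 2) ℚ_[ℓ])),
      ∃ k : GL (Fin 2) ℚ_[ℓ], IsIntegralGL ℓ k ∧
        ‖(k : Matrix (Fin 2) (Fin 2) ℚ_[ℓ]) 1 0‖ ≤ (ℓ : ℝ)⁻¹ ∧
        ‖(k : Matrix (Fin 2) (Fin 2) ℚ_[ℓ]) 1 1 - 1‖ ≤ (ℓ : ℝ)⁻¹ ∧
        (k : Matrix (Fin 2) (Fin 2) ℚ_[ℓ]) =
          m⁻¹ * (h₂ : Matrix (Fin 2) (Fin 2) ℚ_[ℓ]) * m) := by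
  have hℓ : (1 : ℝ) ≤ ℓ := Nat.one_le_cast.mpr (Fact.out : ℓ.Prime).one_le
  have hℓ0 : (ℓ : ℚ_[ℓ]) ≠ 0 := Nat.cast_ne_zero.mpr (Fact.out : ℓ.Prime).ne_zero
  have hr : ((ℓ : ℝ) ^ 2)⁻¹ ≤ 1 := inv_le_one_of_one_le₀ (one_le_pow₀ hℓ)
  refine ⟨fun v => ?_, ?_, ?_⟩
  · obtain ⟨hc', hd'⟩ := inv_bottom_row ℓ h₁int h₁K.1 h₁K.2
    have hback : Matrix.vecMul (Matrix.vecMul v h₁.1) (h₁⁻¹).1 = v := by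
      rw [Matrix.vecMul_vecMul, Units.mul_inv, Matrix.vecMul_one]
    have hiff : (‖Matrix.vecMul v h₁.1 0‖ ≤ ((ℓ : ℝ) ^ 2)⁻¹ ∧
        ‖Matrix.vecMul v h₁.1 1 - 1‖ ≤ ((ℓ : ℝ) ^ 2)⁻¹) ↔
        (‖v 0‖ ≤ ((ℓ : ℝ) ^ 2)⁻¹ ∧ ‖v 1 - 1‖ ≤ ((ℓ : ℝ) ^ 2)⁻¹) := by
      refine ⟨fun hv => ?_, vecMul_mem_support ℓ hr h₁int h₁K.1 h₁K.2⟩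
      have := vecMul_mem_support ℓ hr h₁int.inv hc' hd' hv
      rwa [hback] at this
    classical
    simp only [phiL2, Set.indicator_apply, Set.mem_ofPred_eq, hiff]
  · refine ⟨(etaGL ℓ)⁻¹ * iotaGL ℓ h₁ h₂ * etaGL ℓ,
      ((isGSp4_etaGL ℓ).inv.mul (isGSp4_iotaGL ℓ hdet)).mul (isGSp4_etaGL ℓ),
      isIntegralGL_conj_iotaGL ℓ h₁int h₂int h₁K.1 h₁K.2 h₂K.1 h₂K.2 hdet, ?_⟩
    rw [Units.val_mul, Units.val_mul, Matrix.coe_units_inv]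
    rfl
  · rintro m (rfl | rfl)
    · refine conj_antidiagGL_properties ℓ (x := 1) (by simp) ?_ h₂int h₂K.1 h₂K.2
      rw [Units.val_one, div_one, norm_pow, Padic.norm_p]
      exact pow_le_of_le_one (by positivity) (inv_le_one_of_one_le₀ hℓ) two_ne_zero
    · refine conj_antidiagGL_properties ℓ (x := Units.mk0 (ℓ : ℚ_[ℓ]) hℓ0) ?_ ?_
        h₂int h₂K.1 h₂K.2
      · rw [Units.val_mk0, Padic.norm_p]
        exact inv_le_one_of_one_le₀ hℓ
      · rw [Units.val_mk0, pow_two, mul_div_cancel_left₀ _ hℓ0, Padic.norm_p]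

end
end
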